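/- Let c be a nonzero cubic form in n variables with real coefficients, let B, C ≥ 1 be reals, let σ ∈ {0,…,n−1} and k ∈ {0,…,n−σ−1}, and let E_1 ≥ E_2 ≥ … ≥ E_{k+1} be reals with C·B ≥ E_1 and E_{k+1} ≥ 1. Then there is a constant A depending only on C and n such that at least one of the following holds: (I) K_k(E_1,…,E_{k+1}) can be covered by at most A·B^σ·(E_1···E_{k+1})·E_{k+1}^{−σ−k−1} axis-parallel cubes in ℝ^n of side length E_{k+1}, and consequently #(ℤ^n ∩ K_k(E_1,…,E_{k+1})) ≤ A·B^σ·(E_1···E_{k+1})·E_{k+1}^{n−σ−k−1}; (II) there exist an integer b with 1 ≤ b ≤ k, a point x⁰ ∈ K_b(E_1,…,E_{b+1}), and a linear subspace X ⊆ ℝ^n of dimension σ+b+1 such that E_{b+1} < C^{−1}·E_b and ‖J^{(c,b+1)}(x⁰)·X‖_∞ ≤ C^{−1}·‖Δ^{(c,b)}(x⁰)‖_∞·‖X‖_∞ for all X ∈ X; (III) there exists a linear subspace X ⊆ ℝ^n of dimension σ+1 such that every entry of H_c(X) has absolute value at most C^{−1}·‖X‖_∞ for all X ∈ X. -/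

import Mathlib

open MvPolynomial Matrix

/-- `‖c‖ = (1/6)·max_{i,j,k} |∂³c/∂x_i∂x_j∂x_k|` for a cubic form `c`. -/
noncomputable def cubicNorm {n : ℕ} (c : MvPolynomial (Fin n) ℝ) : ℝ :=
  (1 / 6) * ⨆ i : Fin n, ⨆ j : Fin n, ⨆ k : Fin n,
    |MvPolynomial.eval (0 : Fin n → ℝ) (pderiv i (pderiv j (pderiv k c)))|

/-- The normalised Hessian matrix of `c`, as a matrix of polynomials. -/
noncomputable def hessPoly {n : ℕ} (c : MvPolynomial (Fin n) ℝ) :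
    Matrix (Fin n) (Fin n) (MvPolynomial (Fin n) ℝ) :=
  Matrix.of fun i j => MvPolynomial.C (cubicNorm c)⁻¹ * pderiv i (pderiv j c)

/-- The normalised Hessian matrix `H_c(x)` with entries `(1/‖c‖)·∂²c(x)/∂x_i∂x_j`. -/
noncomputable def hessMat {n : ℕ} (c : MvPolynomial (Fin n) ℝ) (x : Fin n → ℝ) :
    Matrix (Fin n) (Fin n) ℝ :=
  Matrix.of fun i j => MvPolynomial.eval x (hessPoly c i j)

/-- Index type for the `k × k` minors of an `n × n` matrix: pairs of strictly
increasing tuples of row and column indices. -/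
abbrev MIdx (n k : ℕ) :=
  {p : (Fin k → Fin n) × (Fin k → Fin n) // StrictMono p.1 ∧ StrictMono p.2}

/-- The `k × k` minors of the Hessian of `c`, as polynomials in `x`. -/
noncomputable def minorPoly {n : ℕ} (c : MvPolynomial (Fin n) ℝ) (k : ℕ)
    (p : MIdx n k) : MvPolynomial (Fin n) ℝ :=
  ((hessPoly c).submatrix p.1.1 p.1.2).det

/-- The vector `Δ^{(c,k)}(x)` of `k × k` minors of `H_c(x)`. -/
noncomputable def minorsVec {n : ℕ} (c : MvPolynomial (Fin n) ℝ) (k : ℕ)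
    (x : Fin n → ℝ) (p : MIdx n k) : ℝ :=
  MvPolynomial.eval x (minorPoly c k p)

/-- The product `J^{(c,k)}(x)·t` of the Jacobian matrix of `Δ^{(c,k)}` at `x`
with a vector `t`. -/
noncomputable def jacMulVec {n : ℕ} (c : MvPolynomial (Fin n) ℝ) (k : ℕ)
    (x t : Fin n → ℝ) (p : MIdx n k) : ℝ :=
  ∑ j : Fin n, MvPolynomial.eval x (pderiv j (minorPoly c k p)) * t j

/-- The supremum norm of a vector indexed by minors. -/
noncomputable def supMIdx {n k : ℕ} (v : MIdx n k → ℝ) : ℝ := ⨆ p, |v p|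

/-- The set `K_k(E_1, …, E_{k+1})` (0-indexed: `E i` is the paper's `E_{i+1}`, and
`lam x i` is the paper's `λ_{i+1}^{(c)}(x)`). -/
def Kset {n : ℕ} (B : ℝ) (lam : (Fin n → ℝ) → Fin n → ℝ) (E : ℕ → ℝ) (k : ℕ) :
    Set (Fin n → ℝ) :=
  {x | (∀ i, |x i| ≤ B) ∧
    (∀ i : Fin n, (i : ℕ) < k → (E (i : ℕ) / 2 < |lam x i| ∧ |lam x i| ≤ E (i : ℕ))) ∧
    (∀ i : Fin n, k ≤ (i : ℕ) → |lam x i| ≤ E k)}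


/-! ### Linear algebra preliminaries -/

lemma aux_exists_perm {n : ℕ} (f g : Fin n → ℝ)
    (h : (∏ i, (Polynomial.X - Polynomial.C (f i))) = ∏ i, (Polynomial.X - Polynomial.C (g i))) :
    ∃ e : Equiv.Perm (Fin n), ∀ i, f i = g (e i) := by
  have hr : Multiset.map f Finset.univ.val = Multiset.map g Finset.univ.val := by
    have := congrArg Polynomial.roots h
    rw [Polynomial.roots_prod, Polynomial.roots_prod] at this
    · simpa using this
    · simp [Finset.prod_ne_zero_iff, Polynomial.X_sub_C_ne_zero]
    · simp [Finset.prod_ne_zero_iff, Polynomial.X_sub_C_ne_zero]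
  have hc : ∀ y : ℝ, Nonempty ({i // f i = y} ≃ {i // g i = y}) := by
    intro y
    have := congrArg (Multiset.count y) hr
    rw [Multiset.count_map, Multiset.count_map] at this
    refine ⟨Fintype.equivOfCardEq ?_⟩
    rw [Fintype.card_subtype, Fintype.card_subtype]
    simpa [Finset.card_def, eq_comm] using this
  have e := fun y => (hc y).some
  refine ⟨(Equiv.sigmaFiberEquiv f).symm.trans
    ((Equiv.sigmaCongrRight e).trans (Equiv.sigmaFiberEquiv g)), ?_⟩
  intro i
  exact ((e (f i)) ⟨i, rfl⟩).2.symm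

lemma aux_diag {n : ℕ} (A : Matrix (Fin n) (Fin n) ℝ) (hA : Aᵀ = A) :
    ∃ (U : Matrix (Fin n) (Fin n) ℝ) (d : Fin n → ℝ), U * Uᵀ = 1 ∧ Uᵀ * U = 1 ∧
      A = U * diagonal d * Uᵀ ∧ A.charpoly = ∏ i, (Polynomial.X - Polynomial.C (d i)) := by
  have hH : A.IsHermitian := by
    rw [Matrix.IsHermitian, Matrix.conjTranspose_eq_transpose_of_trivial, hA]
  have h1 : (hH.eigenvectorUnitary : Matrix (Fin n) (Fin n) ℝ)ᵀ
      = star (hH.eigenvectorUnitary : Matrix (Fin n) (Fin n) ℝ) := by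
    rw [Matrix.star_eq_conjTranspose, Matrix.conjTranspose_eq_transpose_of_trivial]
  refine ⟨hH.eigenvectorUnitary, hH.eigenvalues, ?_, ?_, ?_, ?_⟩
  · rw [h1]; simp
  · rw [h1]; simp
  · rw [h1]
    conv_lhs => rw [hH.spectral_theorem]
    simp [Unitary.conjStarAlgAut_apply]
  · simpa using hH.charpoly_eq

lemma aux_diag_lam {n : ℕ} (A : Matrix (Fin n) (Fin n) ℝ) (hA : Aᵀ = A) (l : Fin n → ℝ)
    (hl : A.charpoly = ∏ i, (Polynomial.X - Polynomial.C (l i))) :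
    ∃ U : Matrix (Fin n) (Fin n) ℝ, U * Uᵀ = 1 ∧ Uᵀ * U = 1 ∧ A = U * diagonal l * Uᵀ := by
  obtain ⟨U, d, h1, h2, h3, h4⟩ := aux_diag A hA
  obtain ⟨e, he⟩ := aux_exists_perm l d (hl.symm.trans h4)
  have hd : diagonal l = (diagonal d).submatrix e e := by
    rw [Matrix.submatrix_diagonal_equiv]
    congr 1
    funext i
    exact he i
  refine ⟨U.submatrix id e, ?_, ?_, ?_⟩
  · rw [Matrix.transpose_submatrix, Matrix.submatrix_mul_equiv, h1]; simp
  · rw [Matrix.transpose_submatrix, ← Matrix.submatrix_mul _ _ e id e Function.bijective_id, h2]; simp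
  · rw [hd, Matrix.transpose_submatrix, Matrix.submatrix_mul_equiv, Matrix.submatrix_mul_equiv, ← h3]
    simp

lemma aux_orth_entry {n : ℕ} (U : Matrix (Fin n) (Fin n) ℝ) (h : U * Uᵀ = 1) (i j : Fin n) :
    |U i j| ≤ 1 := by
  have h1 : ∑ k, U i k * U i k = 1 := by
    have := congrFun (congrFun h i) i
    simpa [Matrix.mul_apply] using this
  have h2 : U i j * U i j ≤ ∑ k, U i k * U i k :=
    Finset.single_le_sum (f := fun k => U i k * U i k) (fun k _ => mul_self_nonneg _)
      (Finset.mem_univ j)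
  rw [abs_le_one_iff_mul_self_le_one]
  linarith

/-- Expansion of the determinant of a product along rows. -/
lemma aux_det_mul_left {m n : ℕ} (A : Matrix (Fin m) (Fin n) ℝ) (M : Matrix (Fin n) (Fin m) ℝ) :
    (A * M).det = ∑ f : Fin m → Fin n, (∏ i, A i (f i)) * (M.submatrix f id).det := by
  have h : (A * M) = fun i => ∑ j, A i j • M j := by
    funext i k
    simp [Matrix.mul_apply, Finset.sum_apply]
  change (Matrix.detRowAlternating : (Fin m → ℝ) [⋀^Fin m]→ₗ[ℝ] ℝ).toMultilinearMap (A * M) = _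
  rw [h, MultilinearMap.map_sum]
  refine Finset.sum_congr rfl fun f _ => ?_
  rw [MultilinearMap.map_smul_univ]
  rfl

lemma aux_det_mul_right {m n : ℕ} (M : Matrix (Fin m) (Fin n) ℝ) (A : Matrix (Fin n) (Fin m) ℝ) :
    (M * A).det = ∑ f : Fin m → Fin n, (∏ i, A (f i) i) * (M.submatrix id f).det := by
  rw [← Matrix.det_transpose, Matrix.transpose_mul, aux_det_mul_left]
  refine Finset.sum_congr rfl fun f _ => ?_
  rw [← Matrix.det_transpose (M.submatrix id f)]
  rfl

lemma aux_det_expand {m n : ℕ} (U N : Matrix (Fin n) (Fin n) ℝ) (r c : Fin m → Fin n) :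
    ((U * N * Uᵀ).submatrix r c).det = ∑ f : Fin m → Fin n, ∑ g : Fin m → Fin n,
      ((∏ i, U (r i) (f i)) * (∏ i, U (c i) (g i))) * (N.submatrix f g).det := by
  have h : (U * N * Uᵀ).submatrix r c = U.submatrix r id * ((N * Uᵀ).submatrix id c) := by
    rw [Matrix.mul_assoc, Matrix.submatrix_mul _ _ r id c Function.bijective_id]
  rw [h, aux_det_mul_left]
  refine Finset.sum_congr rfl fun f _ => ?_
  have h2 : ((N * Uᵀ).submatrix id c).submatrix f id = N.submatrix f id * Uᵀ.submatrix id c := by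
    rw [Matrix.submatrix_submatrix, Matrix.submatrix_mul _ _ _ id _ Function.bijective_id]
    rfl
  rw [h2, aux_det_mul_right, Finset.mul_sum]
  refine Finset.sum_congr rfl fun g _ => ?_
  rw [Matrix.submatrix_submatrix]
  simp [mul_assoc]

/-- Products over a finite set of naturals of an antitone sequence. -/
lemma aux_prod_antitone (a : ℕ → ℝ) (h0 : ∀ i, 0 ≤ a i) (ha : Antitone a) (T : Finset ℕ) :
    ∏ j ∈ T, a j ≤ ∏ j ∈ Finset.range T.card, a j := by
  induction hq : T.card generalizing T with
  | zero => rw [Finset.card_eq_zero] at hq; subst hq; simp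
  | succ q ih =>
    have hne : T.Nonempty := by rw [← Finset.card_pos]; omega
    have hm := T.max'_mem hne
    have hle : q ≤ T.max' hne := by
      have : T ⊆ Finset.range (T.max' hne + 1) := by
        intro x hx
        rw [Finset.mem_range]
        exact Nat.lt_succ_of_le (T.le_max' x hx)
      have := Finset.card_le_card this
      rw [Finset.card_range] at this
      omega
    rw [← Finset.mul_prod_erase T a hm, Finset.prod_range_succ, mul_comm]
    refine mul_le_mul (ih _ ?_) (ha hle) (h0 _) (Finset.prod_nonneg fun i _ => h0 i)
    rw [Finset.card_erase_of_mem hm]; omega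

lemma aux_prod_inj {m n : ℕ} (a : ℕ → ℝ) (h0 : ∀ i, 0 ≤ a i) (ha : Antitone a)
    (f : Fin m → Fin n) (hf : Function.Injective f) (S : Finset (Fin m)) :
    ∏ i ∈ S, a (f i) ≤ ∏ j ∈ Finset.range S.card, a j := by
  have := aux_prod_antitone a h0 ha (S.image (fun i => (f i : ℕ)))
  have hinj : Function.Injective (fun i => (f i : ℕ)) := Fin.val_injective.comp hf
  rwa [Finset.prod_image (fun x _ y _ h => hinj h), Finset.card_image_of_injective _ hinj] at this

/-- Upper bound for minors in terms of eigenvalues. -/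
lemma aux_minor_upper {m n : ℕ} (U : Matrix (Fin n) (Fin n) ℝ) (hU : U * Uᵀ = 1)
    (l : Fin n → ℝ) (a : ℕ → ℝ) (h0 : ∀ i, 0 ≤ a i) (ha : Antitone a) (hl : ∀ i, |l i| ≤ a i)
    (r c : Fin m → Fin n) :
    |((U * diagonal l * Uᵀ).submatrix r c).det| ≤
      ((n ^ m * n ^ m * m.factorial : ℕ) : ℝ) * ∏ j ∈ Finset.range m, a j := by
  have hP : 0 ≤ ∏ j ∈ Finset.range m, a j := Finset.prod_nonneg fun i _ => h0 i
  have hdet : ∀ f g : Fin m → Fin n, |((diagonal l).submatrix f g).det| ≤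
      (m.factorial : ℝ) * ∏ j ∈ Finset.range m, a j := by
    intro f g
    by_cases hf : Function.Injective f
    · rw [← Matrix.det_transpose, Matrix.det_apply]
      refine (Finset.abs_sum_le_sum_abs _ _).trans ?_
      refine (Finset.sum_le_card_nsmul _ _ (∏ j ∈ Finset.range m, a j) ?_).trans ?_
      · intro s _
        have : |∏ i, ((diagonal l).submatrix f g)ᵀ (s i) i| ≤ ∏ j ∈ Finset.range m, a j := by
          rw [Finset.abs_prod]
          refine (Finset.prod_le_prod (g := fun i => a (f i)) (fun i _ => abs_nonneg _) ?_).trans ?_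
          · intro i _
            simp only [Matrix.transpose_apply, Matrix.submatrix_apply, Matrix.diagonal_apply]
            split_ifs
            · exact hl _
            · simpa using h0 _
          · simpa using aux_prod_inj a h0 ha f hf Finset.univ
        rcases Int.units_eq_one_or (Equiv.Perm.sign s) with h | h <;> simpa [h] using this
      · simp [Fintype.card_perm]
    · obtain ⟨i, j, hij, hne⟩ : ∃ i j, f i = f j ∧ i ≠ j := by
        simpa [Function.Injective] using hf
      rw [Matrix.det_zero_of_row_eq hne (by funext k; simp [hij]), abs_zero]
      positivity
  rw [aux_det_expand]
  have hprod : ∀ (r f : Fin m → Fin n), |∏ i, U (r i) (f i)| ≤ 1 := by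
    intro r f
    rw [Finset.abs_prod]
    exact Finset.prod_le_one (fun i _ => abs_nonneg _) (fun i _ => aux_orth_entry U hU _ _)
  calc _ ≤ ∑ f : Fin m → Fin n, ∑ g : Fin m → Fin n,
        (m.factorial : ℝ) * ∏ j ∈ Finset.range m, a j := by
        refine (Finset.abs_sum_le_sum_abs _ _).trans (Finset.sum_le_sum fun f _ => ?_)
        refine (Finset.abs_sum_le_sum_abs _ _).trans (Finset.sum_le_sum fun g _ => ?_)
        rw [abs_mul, abs_mul]
        calc _ ≤ 1 * 1 * |((diagonal l).submatrix f g).det| := by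
              gcongr
              · exact hprod _ _
              · exact hprod _ _
          _ ≤ _ := by rw [one_mul, one_mul]; exact hdet f g
    _ = _ := by simp; ring

/-- Reduction of arbitrary minors to minors with increasing indices. -/
lemma aux_minor_le_sup {m n : ℕ} (M : Matrix (Fin n) (Fin n) ℝ) (r c : Fin m → Fin n) :
    |(M.submatrix r c).det| ≤
      supMIdx (fun p : MIdx n m => (M.submatrix p.1.1 p.1.2).det) := by
  have hs0 : 0 ≤ supMIdx (fun p : MIdx n m => (M.submatrix p.1.1 p.1.2).det) :=
    Real.iSup_nonneg fun p => abs_nonneg _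
  by_cases hr : Function.Injective r
  swap
  · obtain ⟨i, j, hij, hne⟩ : ∃ i j, r i = r j ∧ i ≠ j := by
      simpa [Function.Injective] using hr
    rw [Matrix.det_zero_of_row_eq hne (by funext k; simp [hij]), abs_zero]
    exact hs0
  by_cases hc : Function.Injective c
  swap
  · obtain ⟨i, j, hij, hne⟩ : ∃ i j, c i = c j ∧ i ≠ j := by
      simpa [Function.Injective] using hc
    rw [Matrix.det_zero_of_column_eq hne (by intro k; simp [hij]), abs_zero]
    exact hs0
  have key : ∀ f : Fin m → Fin n, Function.Injective f → StrictMono (f ∘ Tuple.sort f) :=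
    fun f hf => (Tuple.monotone_sort f).strictMono_of_injective
      (hf.comp (Tuple.sort f).injective)
  have hle := le_ciSup (f := fun p : MIdx n m => |(M.submatrix p.1.1 p.1.2).det|)
    (Set.finite_range _).bddAbove ⟨(r ∘ Tuple.sort r, c ∘ Tuple.sort c), key r hr, key c hc⟩
  refine le_trans (le_of_eq ?_) hle
  have e1 : M.submatrix (r ∘ Tuple.sort r) (c ∘ Tuple.sort c) =
      (((M.submatrix r c).submatrix (Tuple.sort r) id).submatrix id (Tuple.sort c)) := rfl
  simp only [e1]
  rw [Matrix.det_permute', Matrix.det_permute, abs_mul, abs_mul]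
  have hu : ∀ s : Equiv.Perm (Fin m), |((Equiv.Perm.sign s : ℤ) : ℝ)| = 1 := by
    intro s
    rcases Int.units_eq_one_or (Equiv.Perm.sign s) with h | h <;> simp [h]
  rw [hu, hu]; simp

/-- Lower bound for minors in terms of eigenvalues. -/
lemma aux_minor_lower {m n : ℕ} (hmn : m ≤ n) (M U : Matrix (Fin n) (Fin n) ℝ)
    (hU' : Uᵀ * U = 1) (l : Fin n → ℝ) (hM : M = U * diagonal l * Uᵀ) :
    ∏ i : Fin m, |l (Fin.castLE hmn i)| ≤ ((n ^ m * n ^ m : ℕ) : ℝ) *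
      supMIdx (fun p : MIdx n m => (M.submatrix p.1.1 p.1.2).det) := by
  have hD : diagonal l = Uᵀ * M * Uᵀᵀ := by
    rw [hM, Matrix.transpose_transpose]
    calc diagonal l = (Uᵀ * U) * diagonal l * (Uᵀ * U) := by rw [hU']; simp
      _ = _ := by simp only [Matrix.mul_assoc]
  have hdet : ((diagonal l).submatrix (Fin.castLE hmn) (Fin.castLE hmn)).det
      = ∏ i : Fin m, l (Fin.castLE hmn i) := by
    rw [Matrix.submatrix_diagonal _ _ (Fin.castLE_injective hmn), Matrix.det_diagonal]
    rfl
  rw [← Finset.abs_prod, ← hdet, hD, aux_det_expand]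
  have hU2 : Uᵀ * Uᵀᵀ = 1 := by simpa using hU'
  have hprod : ∀ (r f : Fin m → Fin n), |∏ i, Uᵀ (r i) (f i)| ≤ 1 := by
    intro r f
    rw [Finset.abs_prod]
    exact Finset.prod_le_one (fun i _ => abs_nonneg _) (fun i _ => aux_orth_entry Uᵀ hU2 _ _)
  calc _ ≤ ∑ f : Fin m → Fin n, ∑ g : Fin m → Fin n,
        supMIdx (fun p : MIdx n m => (M.submatrix p.1.1 p.1.2).det) := by
        refine (Finset.abs_sum_le_sum_abs _ _).trans (Finset.sum_le_sum fun f _ => ?_)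
        refine (Finset.abs_sum_le_sum_abs _ _).trans (Finset.sum_le_sum fun g _ => ?_)
        rw [abs_mul, abs_mul]
        calc _ ≤ 1 * 1 * |(M.submatrix f g).det| := by
              gcongr
              · exact hprod _ _
              · exact hprod _ _
          _ ≤ _ := by rw [one_mul, one_mul]; exact aux_minor_le_sup M f g
    _ = _ := by simp; ring

/-! ### Singular values and coverings -/

lemma aux_sq_le_sum {ι : Type*} [Fintype ι] (v : ι → ℝ) : ‖v‖ ^ 2 ≤ ∑ i, v i ^ 2 := by
  have h0 : 0 ≤ ∑ i, v i ^ 2 := Finset.sum_nonneg fun i _ => sq_nonneg _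
  have : ‖v‖ ≤ Real.sqrt (∑ i, v i ^ 2) := by
    rw [pi_norm_le_iff_of_nonneg (Real.sqrt_nonneg _)]
    intro i
    apply Real.le_sqrt_of_sq_le
    rw [Real.norm_eq_abs, sq_abs]
    exact Finset.single_le_sum (f := fun i => v i ^ 2) (fun i _ => sq_nonneg _) (Finset.mem_univ i)
  calc ‖v‖ ^ 2 ≤ (Real.sqrt (∑ i, v i ^ 2)) ^ 2 := by gcongr
    _ = _ := Real.sq_sqrt h0

lemma aux_sum_le_sq {ι : Type*} [Fintype ι] (v : ι → ℝ) :
    ∑ i, v i ^ 2 ≤ (Fintype.card ι : ℝ) * ‖v‖ ^ 2 := by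
  calc ∑ i, v i ^ 2 ≤ ∑ i : ι, ‖v‖ ^ 2 := by
        refine Finset.sum_le_sum fun i _ => ?_
        rw [← sq_abs, ← Real.norm_eq_abs]
        have := norm_le_pi_norm v i
        gcongr
    _ = _ := by simp

lemma aux_orth_sum {n : ℕ} (U : Matrix (Fin n) (Fin n) ℝ) (hU : U * Uᵀ = 1) (v : Fin n → ℝ) :
    ∑ i, ((Uᵀ *ᵥ v) i) ^ 2 = ∑ i, v i ^ 2 := by
  have h : (Uᵀ *ᵥ v) ⬝ᵥ (Uᵀ *ᵥ v) = v ⬝ᵥ v := by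
    rw [Matrix.dotProduct_mulVec, Matrix.vecMul_transpose, Matrix.mulVec_mulVec, hU,
      Matrix.one_mulVec]
  simpa [dotProduct, sq] using h

lemma aux_sv {ι : Type*} [Fintype ι] {n : ℕ} (L : (Fin n → ℝ) →ₗ[ℝ] (ι → ℝ)) (ε : ℝ) (hε : 0 < ε)
    (d : ℕ) (hX : ∀ X : Submodule ℝ (Fin n → ℝ), Module.finrank ℝ X = d + 1 →
      ∃ v ∈ X, ε * ‖v‖ < ‖L v‖) :
    ∃ S : Finset (Fin n), S.card ≤ d ∧ ∃ W : Matrix (Fin n) (Fin n) ℝ,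
      (∀ v i, |(W *ᵥ v) i| ≤ n * ‖v‖) ∧
      ∀ v δ, 0 ≤ δ → (∀ i ∈ S, |(W *ᵥ v) i| ≤ δ) →
        ‖v‖ ≤ n * (δ + (n + 1) * (Fintype.card ι + 1) * (ε⁻¹ * ‖L v‖)) := by
  classical
  set Lm := LinearMap.toMatrix' L with hLm
  have hLv : ∀ v, L v = Lm *ᵥ v := fun v => by
    rw [hLm, ← Matrix.toLin'_apply, Matrix.toLin'_toMatrix']
  obtain ⟨U, d', hU, hU', hA, -⟩ := aux_diag (Lmᵀ * Lm) (by
    rw [Matrix.transpose_mul, Matrix.transpose_transpose])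
  have hQ : ∀ v, ∑ a, (L v a) ^ 2 = ∑ i, d' i * ((Uᵀ *ᵥ v) i) ^ 2 := by
    intro v
    have h1 : ∑ a, (L v a) ^ 2 = v ⬝ᵥ ((Lmᵀ * Lm) *ᵥ v) := by
      rw [← Matrix.mulVec_mulVec, Matrix.dotProduct_mulVec, Matrix.vecMul_transpose, hLv]
      simp [dotProduct, sq]
    rw [h1, hA, ← Matrix.mulVec_mulVec, ← Matrix.mulVec_mulVec, Matrix.dotProduct_mulVec,
      ← Matrix.mulVec_transpose]
    simp only [dotProduct, Matrix.mulVec_diagonal]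
    exact Finset.sum_congr rfl fun i _ => by ring
  have hWU : ∀ w, Uᵀ *ᵥ (U *ᵥ w) = w := fun w => by
    rw [Matrix.mulVec_mulVec, hU', Matrix.one_mulVec]
  have hUW : ∀ v, U *ᵥ (Uᵀ *ᵥ v) = v := fun w => by
    rw [Matrix.mulVec_mulVec, hU, Matrix.one_mulVec]
  have hd0 : ∀ j, 0 ≤ d' j := by
    intro j
    have h := hQ (U *ᵥ Pi.single j 1)
    rw [hWU] at h
    have h2 : ∑ i, d' i * ((Pi.single j 1 : Fin n → ℝ) i) ^ 2 = d' j := by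
      rw [Finset.sum_eq_single j]
      · simp
      · intro b _ hb; simp [hb]
      · simp
    rw [h2] at h
    rw [← h]
    exact Finset.sum_nonneg fun i _ => sq_nonneg _
  have hent : ∀ (V : Matrix (Fin n) (Fin n) ℝ), V * Vᵀ = 1 → ∀ (w : Fin n → ℝ) b, 0 ≤ b →
      (∀ i, |w i| ≤ b) → ∀ i, |(V *ᵥ w) i| ≤ n * b := by
    intro V hV w b hb hw i
    calc |(V *ᵥ w) i| = |∑ j, V i j * w j| := rfl
      _ ≤ ∑ j, |V i j * w j| := Finset.abs_sum_le_sum_abs _ _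
      _ ≤ ∑ j : Fin n, b := by
        refine Finset.sum_le_sum fun j _ => ?_
        rw [abs_mul]
        calc _ ≤ 1 * b := mul_le_mul (aux_orth_entry V hV i j) (hw j) (abs_nonneg _) zero_le_one
          _ = b := one_mul b
      _ = n * b := by simp
  have hn1 : (0 : ℝ) < n + 1 := by positivity
  set S : Finset (Fin n) := Finset.univ.filter fun i => d' i ≤ ε ^ 2 / (n + 1) with hS
  refine ⟨S, ?_, Uᵀ, ?_, ?_⟩
  · by_contra hcard
    push Not at hcard
    obtain ⟨S', hS'S, hS'c⟩ := Finset.exists_subset_card_eq (Nat.succ_le_of_lt hcard)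
    have hunit : IsUnit U := IsUnit.of_mul_eq_one _ hU
    have hli : LinearIndependent ℝ (fun i : S' => U.col i) :=
      (Matrix.linearIndependent_cols_of_isUnit hunit).comp _ Subtype.val_injective
    have hz' : ∀ v ∈ Submodule.span ℝ (Set.range (fun i : S' => U.col i)),
        ∀ i, i ∉ S' → (Uᵀ *ᵥ v) i = 0 := by
      intro v hv i hi
      induction hv using Submodule.span_induction with
      | mem x hx =>
        obtain ⟨j, rfl⟩ := hx
        have : U.col j = U *ᵥ Pi.single (j : Fin n) 1 := by simp
        simp only [this]
        rw [hWU]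
        have : i ≠ (j : Fin n) := fun h => hi (h ▸ j.2)
        simp [this]
      | zero => simp
      | add x y _ _ hx hy => rw [Matrix.mulVec_add, Pi.add_apply, hx, hy, add_zero]
      | smul a x _ hx => rw [Matrix.mulVec_smul, Pi.smul_apply, hx, smul_zero]
    obtain ⟨v, hv, hlt⟩ := hX (Submodule.span ℝ (Set.range (fun i : S' => U.col i))) (by
      rw [finrank_span_eq_card hli]; simpa using hS'c)
    have hz := hz' v hv
    have h1 : ‖L v‖ ^ 2 ≤ (ε * ‖v‖) ^ 2 := by
      calc ‖L v‖ ^ 2 ≤ ∑ a, (L v a) ^ 2 := aux_sq_le_sum _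
        _ = ∑ i, d' i * ((Uᵀ *ᵥ v) i) ^ 2 := hQ v
        _ ≤ ∑ i, ε ^ 2 / (n + 1) * ((Uᵀ *ᵥ v) i) ^ 2 := by
          refine Finset.sum_le_sum fun i _ => ?_
          by_cases hi : i ∈ S'
          · have := hS'S hi
            rw [hS, Finset.mem_filter] at this
            exact mul_le_mul_of_nonneg_right this.2 (sq_nonneg _)
          · simp [hz i hi]
        _ = ε ^ 2 / (n + 1) * ∑ i, v i ^ 2 := by rw [← Finset.mul_sum, aux_orth_sum U hU]
        _ ≤ ε ^ 2 / (n + 1) * (n * ‖v‖ ^ 2) := by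
          have := aux_sum_le_sq v
          rw [Fintype.card_fin] at this
          gcongr
        _ ≤ ε ^ 2 / (n + 1) * ((n + 1) * ‖v‖ ^ 2) := by gcongr; linarith
        _ = (ε * ‖v‖) ^ 2 := by field_simp
    have h2 := abs_le_of_sq_le_sq h1 (by positivity)
    rw [abs_norm] at h2
    linarith
  · intro v
    exact hent Uᵀ (by simpa using hU') v ‖v‖ (norm_nonneg _) fun i => norm_le_pi_norm v i
  · intro v δ hδ hv
    set b := δ + (n + 1) * (Fintype.card ι + 1) * (ε⁻¹ * ‖L v‖) with hb
    have hb' : 0 ≤ (n + 1 : ℝ) * (Fintype.card ι + 1) * (ε⁻¹ * ‖L v‖) := by positivity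
    have hb0 : 0 ≤ b := by positivity
    have hw : ∀ i, |(Uᵀ *ᵥ v) i| ≤ b := by
      intro i
      by_cases hi : i ∈ S
      · linarith [hv i hi]
      · have hdi : ε ^ 2 / (n + 1) < d' i := by
          rw [hS, Finset.mem_filter] at hi
          simpa using hi
        have h1 : ε ^ 2 / (n + 1) * ((Uᵀ *ᵥ v) i) ^ 2 ≤ (Fintype.card ι : ℝ) * ‖L v‖ ^ 2 := by
          calc _ ≤ d' i * ((Uᵀ *ᵥ v) i) ^ 2 := by gcongr
            _ ≤ ∑ i, d' i * ((Uᵀ *ᵥ v) i) ^ 2 :=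
              Finset.single_le_sum (f := fun i => d' i * ((Uᵀ *ᵥ v) i) ^ 2)
                (fun i _ => mul_nonneg (hd0 i) (sq_nonneg _)) (Finset.mem_univ i)
            _ = ∑ a, (L v a) ^ 2 := (hQ v).symm
            _ ≤ _ := aux_sum_le_sq _
        have h2 : ((Uᵀ *ᵥ v) i) ^ 2 ≤ ((n + 1) * (Fintype.card ι + 1) * (ε⁻¹ * ‖L v‖)) ^ 2 := by
          calc ((Uᵀ *ᵥ v) i) ^ 2 = (n + 1) * ε⁻¹ ^ 2 * (ε ^ 2 / (n + 1) * ((Uᵀ *ᵥ v) i) ^ 2) := by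
                field_simp
            _ ≤ (n + 1) * ε⁻¹ ^ 2 * ((Fintype.card ι : ℝ) * ‖L v‖ ^ 2) := by gcongr
            _ = ((n + 1) * Fintype.card ι) * (ε⁻¹ * ‖L v‖) ^ 2 := by ring
            _ ≤ ((n + 1) * (Fintype.card ι + 1)) ^ 2 * (ε⁻¹ * ‖L v‖) ^ 2 := by
              have : (0 : ℝ) ≤ n := by positivity
              have h3 : (0 : ℝ) ≤ Fintype.card ι := by positivity
              have h4 : (n + 1 : ℝ) * Fintype.card ι ≤ ((n + 1) * (Fintype.card ι + 1)) ^ 2 := by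
                have h5 : (1 : ℝ) ≤ (n + 1) * (Fintype.card ι + 1) := by nlinarith
                nlinarith
              gcongr
            _ = _ := by ring
        have h3 := Real.abs_le_sqrt h2
        rw [Real.sqrt_sq hb'] at h3
        linarith
    rw [pi_norm_le_iff_of_nonneg (by positivity)]
    intro i
    have := hent U hU (Uᵀ *ᵥ v) b hb0 hw i
    rwa [hUW] at this

/-- `K` can be covered by at most `N` closed axis-parallel cubes of side `ρ`. -/
def Cov {n : ℕ} (K : Set (Fin n → ℝ)) (ρ N : ℝ) : Prop :=
  ∃ T : Finset (Fin n → ℝ), (T.card : ℝ) ≤ N ∧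
    K ⊆ ⋃ z ∈ T, {x | ∀ i, z i ≤ x i ∧ x i ≤ z i + ρ}

lemma Cov.mono {n : ℕ} {K K' : Set (Fin n → ℝ)} {ρ N N' : ℝ} (h : Cov K ρ N) (hK : K' ⊆ K)
    (hN : N ≤ N') : Cov K' ρ N' := by
  obtain ⟨T, h1, h2⟩ := h
  exact ⟨T, h1.trans hN, hK.trans h2⟩

lemma aux_cov_union {n : ℕ} {α : Type*} (F : Finset α) (K : Set (Fin n → ℝ))
    (Ks : α → Set (Fin n → ℝ)) (ρ N : ℝ) (hK : K ⊆ ⋃ a ∈ F, Ks a)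
    (h : ∀ a ∈ F, Cov (Ks a) ρ N) : Cov K ρ (F.card * N) := by
  classical
  choose! T hT1 hT2 using h
  refine ⟨F.biUnion T, ?_, ?_⟩
  · calc ((F.biUnion T).card : ℝ) ≤ ((∑ a ∈ F, (T a).card : ℕ) : ℝ) := by
          exact_mod_cast Finset.card_biUnion_le
      _ = ∑ a ∈ F, ((T a).card : ℝ) := by push_cast; rfl
      _ ≤ ∑ a ∈ F, N := Finset.sum_le_sum hT1
      _ = _ := by simp
  · intro x hx
    have := hK hx
    simp only [Set.mem_iUnion] at this
    obtain ⟨a, ha, hxa⟩ := this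
    have := hT2 a ha hxa
    simp only [Set.mem_iUnion] at this ⊢
    obtain ⟨z, hz, hxz⟩ := this
    exact ⟨z, Finset.mem_biUnion.2 ⟨a, ha, hz⟩, hxz⟩

lemma aux_cov_cube {n : ℕ} (z : Fin n → ℝ) (R ρ : ℝ) (hR : 0 ≤ R) (hρ : 0 < ρ) :
    Cov {x : Fin n → ℝ | ∀ i, z i ≤ x i ∧ x i ≤ z i + R} ρ ((R / ρ + 1) ^ n) := by
  classical
  set N := ⌊R / ρ⌋₊ with hN
  refine ⟨Finset.univ.image (fun (a : Fin n → Fin (N + 1)) i => z i + (a i : ℕ) * ρ), ?_, ?_⟩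
  · calc _ ≤ ((Finset.univ : Finset (Fin n → Fin (N + 1))).card : ℝ) := by
          exact_mod_cast Finset.card_image_le
      _ = ((N : ℝ) + 1) ^ n := by simp
      _ ≤ _ := by
        have : (N : ℝ) ≤ R / ρ := Nat.floor_le (by positivity)
        gcongr
  · intro x hx
    simp only [Set.mem_iUnion]
    have hle : ∀ i, ⌊(x i - z i) / ρ⌋₊ < N + 1 := by
      intro i
      refine Nat.lt_succ_of_le (Nat.floor_le_floor ?_)
      have := (hx i).2
      gcongr
      linarith
    refine ⟨fun i => z i + ((⟨⌊(x i - z i) / ρ⌋₊, hle i⟩ : Fin (N + 1)) : ℕ) * ρ,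
      Finset.mem_image.2 ⟨_, Finset.mem_univ _, rfl⟩, ?_⟩
    intro i
    have h0 : 0 ≤ (x i - z i) / ρ := div_nonneg (by linarith [(hx i).1]) hρ.le
    have h1 := Nat.floor_le h0
    have h2 := (Nat.lt_floor_add_one ((x i - z i) / ρ)).le
    rw [le_div_iff₀ hρ] at h1
    rw [div_le_iff₀ hρ] at h2
    constructor
    · simp only; linarith
    · simp only; linarith

lemma aux_cov_ball {n : ℕ} (K : Set (Fin n → ℝ)) (y : Fin n → ℝ) (M ρ : ℝ) (hM : 0 ≤ M)
    (hρ : 0 < ρ) (hK : ∀ x ∈ K, ‖x - y‖ ≤ M * ρ) : Cov K ρ ((2 * M + 1) ^ n) := by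
  refine (aux_cov_cube (fun i => y i - M * ρ) (2 * (M * ρ)) ρ (by positivity) hρ).mono ?_
    (le_of_eq ?_)
  · intro x hx i
    have h1 := (norm_le_pi_norm (x - y) i).trans (hK x hx)
    rw [Real.norm_eq_abs, Pi.sub_apply, abs_le] at h1
    constructor <;> linarith
  · congr 2; field_simp

lemma aux_cov_proj {n : ℕ} (K : Set (Fin n → ℝ)) (x0 : Fin n → ℝ) (R M ρ : ℝ) (hM : 0 ≤ M)
    (hR : 0 ≤ R) (hρ : 0 < ρ) (hK : ∀ x ∈ K, ‖x - x0‖ ≤ R) (S : Finset (Fin n))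
    (W : Matrix (Fin n) (Fin n) ℝ) (hW : ∀ v i, |(W *ᵥ v) i| ≤ n * ‖v‖)
    (h : ∀ x ∈ K, ∀ y ∈ K, (∀ i ∈ S, |(W *ᵥ (x - y)) i| ≤ ρ) → ‖x - y‖ ≤ M * ρ) :
    Cov K ρ ((2 * n * R / ρ + 1) ^ S.card * (2 * M + 1) ^ n) := by
  classical
  set N := ⌊2 * n * R / ρ⌋₊ with hN
  set φ : (Fin n → ℝ) → Fin n → ℕ := fun x i => ⌊((W *ᵥ (x - x0)) i + n * R) / ρ⌋₊ with hφ
  have hnR : ∀ x ∈ K, ∀ i, |(W *ᵥ (x - x0)) i| ≤ n * R := fun x hx i =>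
    (hW _ i).trans (by have := hK x hx; gcongr)
  have hcov := aux_cov_union (Finset.univ : Finset (S → Fin (N + 1))) K
    (fun a => {x ∈ K | ∀ i : S, φ x i = a i}) ρ ((2 * M + 1) ^ n) ?_ ?_
  · refine hcov.mono subset_rfl ?_
    have : (N : ℝ) ≤ 2 * n * R / ρ := Nat.floor_le (by positivity)
    simp only [Finset.card_univ, Fintype.card_fun, Fintype.card_fin, Fintype.card_coe]
    push_cast
    gcongr
  · intro x hx
    simp only [Set.mem_iUnion]
    have hlt : ∀ i, φ x i < N + 1 := by
      intro i
      refine Nat.lt_succ_of_le (Nat.floor_le_floor ?_)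
      have := (abs_le.1 (hnR x hx i)).2
      gcongr
      linarith
    exact ⟨fun i => ⟨φ x i, hlt i⟩, Finset.mem_univ _, hx, fun i => rfl⟩
  · intro a _
    rcases Set.eq_empty_or_nonempty {x ∈ K | ∀ i : S, φ x i = a i} with he | ⟨y, hyK, hy⟩
    · rw [he]
      exact ⟨∅, by simp; positivity, by simp⟩
    · refine aux_cov_ball _ y M ρ hM hρ ?_
      rintro x ⟨hxK, hx⟩
      refine h x hxK y hyK fun i hi => ?_
      have hxy : φ x i = φ y i := (hx ⟨i, hi⟩).trans (hy ⟨i, hi⟩).symm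
      have hx0 : 0 ≤ ((W *ᵥ (x - x0)) i + n * R) / ρ :=
        div_nonneg (by linarith [(abs_le.1 (hnR x hxK i)).1]) hρ.le
      have hy0 : 0 ≤ ((W *ᵥ (y - x0)) i + n * R) / ρ :=
        div_nonneg (by linarith [(abs_le.1 (hnR y hyK i)).1]) hρ.le
      have h1 := Nat.floor_le hx0
      have h2 := (Nat.lt_floor_add_one (((W *ᵥ (x - x0)) i + n * R) / ρ)).le
      have h3 := Nat.floor_le hy0
      have h4 := (Nat.lt_floor_add_one (((W *ᵥ (y - x0)) i + n * R) / ρ)).le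
      simp only [hφ] at hxy
      rw [hxy] at h1 h2
      rw [le_div_iff₀ hρ] at h1 h3
      rw [div_le_iff₀ hρ] at h2 h4
      have e : (W *ᵥ (x - y)) i = (W *ᵥ (x - x0)) i - (W *ᵥ (y - x0)) i := by
        rw [← Pi.sub_apply, ← Matrix.mulVec_sub]
        rw [sub_sub_sub_cancel_right]
      rw [e, abs_le]
      constructor <;> linarith

/-! ### The Hessian -/

lemma aux_pderiv_comm {n : ℕ} (i j : Fin n) (p : MvPolynomial (Fin n) ℝ) :
    pderiv i (pderiv j p) = pderiv j (pderiv i p) := by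
  have h : ⁅(pderiv i : Derivation ℝ (MvPolynomial (Fin n) ℝ) (MvPolynomial (Fin n) ℝ)),
      (pderiv j : Derivation ℝ (MvPolynomial (Fin n) ℝ) (MvPolynomial (Fin n) ℝ))⁆ = 0 := by
    apply MvPolynomial.derivation_ext
    intro k
    rw [Derivation.commutator_apply]
    simp only [pderiv_X, Pi.single_apply]
    split_ifs <;> simp
  have h2 := congrArg (fun D : Derivation ℝ (MvPolynomial (Fin n) ℝ) (MvPolynomial (Fin n) ℝ) => D p) h
  simp only [Derivation.commutator_apply] at h2
  exact sub_eq_zero.1 h2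

lemma aux_eval_deg_zero {n : ℕ} (p : MvPolynomial (Fin n) ℝ) (hp : p.IsHomogeneous 0)
    (x : Fin n → ℝ) : MvPolynomial.eval x p = MvPolynomial.eval 0 p := by
  rw [← totalDegree_zero_iff_isHomogeneous, totalDegree_eq_zero_iff_eq_C] at hp
  rw [hp]; simp

/-- The Hessian in terms of third derivatives. -/
lemma aux_hess_eq {n : ℕ} (c : MvPolynomial (Fin n) ℝ) (hc : c.IsHomogeneous 3) (x : Fin n → ℝ)
    (i j : Fin n) : hessMat c x i j = ∑ k, x k *
      ((cubicNorm c)⁻¹ * MvPolynomial.eval 0 (pderiv k (pderiv i (pderiv j c)))) := by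
  have h2 : (pderiv i (pderiv j c)).IsHomogeneous 1 := hc.pderiv.pderiv
  have h3 : ∀ k, (pderiv k (pderiv i (pderiv j c))).IsHomogeneous 0 := fun k => h2.pderiv
  have he := congrArg (MvPolynomial.eval x) h2.sum_X_mul_pderiv
  simp only [map_sum, map_mul, eval_X, one_smul] at he
  simp only [hessMat, hessPoly, Matrix.of_apply, map_mul, eval_C]
  rw [← he, Finset.mul_sum]
  refine Finset.sum_congr rfl fun k _ => ?_
  rw [aux_eval_deg_zero _ (h3 k)]
  ring

lemma aux_third_bound {n : ℕ} (c : MvPolynomial (Fin n) ℝ) (i j k : Fin n) :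
    |(cubicNorm c)⁻¹ * MvPolynomial.eval (0 : Fin n → ℝ) (pderiv i (pderiv j (pderiv k c)))| ≤ 6 := by
  set t := |MvPolynomial.eval (0 : Fin n → ℝ) (pderiv i (pderiv j (pderiv k c)))| with ht
  have h1 : t ≤ 6 * cubicNorm c := by
    have a1 := le_ciSup (f := fun k : Fin n =>
      |MvPolynomial.eval (0 : Fin n → ℝ) (pderiv i (pderiv j (pderiv k c)))|)
      (Set.finite_range _).bddAbove k
    have a2 := le_ciSup (f := fun j : Fin n => ⨆ k : Fin n,
      |MvPolynomial.eval (0 : Fin n → ℝ) (pderiv i (pderiv j (pderiv k c)))|)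
      (Set.finite_range _).bddAbove j
    have a3 := le_ciSup (f := fun i : Fin n => ⨆ j : Fin n, ⨆ k : Fin n,
      |MvPolynomial.eval (0 : Fin n → ℝ) (pderiv i (pderiv j (pderiv k c)))|)
      (Set.finite_range _).bddAbove i
    have := a1.trans (a2.trans a3)
    unfold cubicNorm
    linarith
  have h0 : 0 ≤ t := abs_nonneg _
  have hc0 : 0 ≤ cubicNorm c := by linarith
  rw [abs_mul, abs_of_nonneg (inv_nonneg.2 hc0), ← ht]
  rcases hc0.eq_or_lt with h | h
  · rw [← h]; simp
  · rw [inv_mul_le_iff₀ h]; linarith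

lemma aux_hess_bound {n : ℕ} (c : MvPolynomial (Fin n) ℝ) (hc : c.IsHomogeneous 3) (x : Fin n → ℝ)
    (i j : Fin n) : |hessMat c x i j| ≤ 6 * n * ‖x‖ := by
  rw [aux_hess_eq c hc]
  calc _ ≤ ∑ k : Fin n, ‖x‖ * 6 := by
        refine (Finset.abs_sum_le_sum_abs _ _).trans (Finset.sum_le_sum fun k _ => ?_)
        rw [abs_mul]
        exact mul_le_mul (norm_le_pi_norm x k) (aux_third_bound c k i j) (abs_nonneg _)
          (norm_nonneg _)
    _ = _ := by simp; ring

lemma aux_hess_symm {n : ℕ} (c : MvPolynomial (Fin n) ℝ) (x : Fin n → ℝ) :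
    (hessMat c x)ᵀ = hessMat c x := by
  ext i j
  simp only [Matrix.transpose_apply, hessMat, hessPoly, Matrix.of_apply]
  rw [aux_pderiv_comm]

lemma aux_hess_add {n : ℕ} (c : MvPolynomial (Fin n) ℝ) (hc : c.IsHomogeneous 3)
    (x y : Fin n → ℝ) : hessMat c (x + y) = hessMat c x + hessMat c y := by
  ext i j
  rw [Matrix.add_apply]
  simp only [aux_hess_eq c hc, Pi.add_apply, add_mul, Finset.sum_add_distrib]

lemma aux_hess_smul {n : ℕ} (c : MvPolynomial (Fin n) ℝ) (hc : c.IsHomogeneous 3) (a : ℝ)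
    (x : Fin n → ℝ) : hessMat c (a • x) = a • hessMat c x := by
  ext i j
  rw [Matrix.smul_apply]
  simp only [aux_hess_eq c hc, Pi.smul_apply, smul_eq_mul, Finset.mul_sum, mul_assoc]

lemma aux_minors_eq {n : ℕ} (c : MvPolynomial (Fin n) ℝ) (k : ℕ) (x : Fin n → ℝ) (p : MIdx n k) :
    minorsVec c k x p = ((hessMat c x).submatrix p.1.1 p.1.2).det := by
  unfold minorsVec minorPoly
  rw [RingHom.map_det]
  rfl

/-- The directional derivative of a polynomial. -/
lemma aux_hasDerivAt {n : ℕ} (p : MvPolynomial (Fin n) ℝ) (x v : Fin n → ℝ) :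
    HasDerivAt (fun τ : ℝ => MvPolynomial.eval (x + τ • v) p)
      (∑ j, MvPolynomial.eval x (pderiv j p) * v j) 0 := by
  induction p using MvPolynomial.induction_on with
  | C a => simpa using hasDerivAt_const (0 : ℝ) a
  | add p q hp hq =>
    have := hp.add hq
    simp only [map_add, add_mul, Finset.sum_add_distrib]
    exact this
  | mul_X p i hp =>
    have h1 : HasDerivAt (fun τ : ℝ => x i + τ * v i) (v i) 0 := by
      simpa using ((hasDerivAt_id (0 : ℝ)).mul_const (v i)).const_add (x i)
    have h2 := hp.mul h1
    simp only [map_mul, eval_X, Pi.add_apply, Pi.smul_apply, smul_eq_mul]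
    refine h2.congr_deriv ?_
    simp only [Derivation.leibniz, pderiv_X, smul_eq_mul, map_add, map_mul, eval_X, add_mul,
      Finset.sum_add_distrib, zero_smul, add_zero, zero_mul]
    have hs : ∑ j, MvPolynomial.eval x p * MvPolynomial.eval x
        ((Pi.single i 1 : Fin n → MvPolynomial (Fin n) ℝ) j) * v j
        = MvPolynomial.eval x p * v i := by
      rw [Finset.sum_eq_single i]
      · simp
      · intro b _ hb
        simp [hb]
      · simp
    have hs2 : ∑ j, x i * MvPolynomial.eval x (pderiv j p) * v j =
        (∑ j, MvPolynomial.eval x (pderiv j p) * v j) * x i := by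
      rw [Finset.sum_mul]
      exact Finset.sum_congr rfl fun j _ => by ring
    rw [hs2, add_comm, ← hs]
    congr 1
    refine Finset.sum_congr rfl fun j _ => ?_
    rw [Pi.single_comm]

/-! ### Taylor expansion of minors -/

/-- `f` is approximated at scale `R` by a linear map with quadratic error. -/
def Approx {n : ℕ} (R K : ℝ) (f : (Fin n → ℝ) → ℝ) : Prop :=
  ∃ L : (Fin n → ℝ) →ₗ[ℝ] ℝ, ∀ r s t, 0 < r → r ≤ R → ‖s‖ ≤ r → ‖t‖ ≤ r →
    |f s - f t - L (s - t)| ≤ K * r * ‖s - t‖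

lemma Approx.sum {n : ℕ} {ι : Type*} (F : Finset ι) (R : ℝ) (K : ι → ℝ)
    (f : ι → (Fin n → ℝ) → ℝ) (h : ∀ i ∈ F, Approx R (K i) (f i)) :
    Approx R (∑ i ∈ F, K i) (fun s => ∑ i ∈ F, f i s) := by
  choose! L hL using h
  refine ⟨∑ i ∈ F, L i, fun r s t h0 hr hs ht => ?_⟩
  rw [LinearMap.sum_apply, ← Finset.sum_sub_distrib, ← Finset.sum_sub_distrib, Finset.sum_mul,
    Finset.sum_mul]
  exact (Finset.abs_sum_le_sum_abs _ _).trans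
    (Finset.sum_le_sum fun i hi => hL i hi r s t h0 hr hs ht)

lemma Approx.const_mul {n : ℕ} {R K : ℝ} {f : (Fin n → ℝ) → ℝ} (h : Approx R K f)
    (a : ℝ) (ha : |a| ≤ 1) : Approx R K (fun s => a * f s) := by
  obtain ⟨L, hL⟩ := h
  refine ⟨a • L, fun r s t h0 hr hs ht => ?_⟩
  have h1 := hL r s t h0 hr hs ht
  rw [LinearMap.smul_apply, smul_eq_mul, ← mul_sub, ← mul_sub, abs_mul]
  calc _ ≤ 1 * |f s - f t - L (s - t)| := by gcongr
    _ ≤ _ := by rw [one_mul]; exact h1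

lemma aux_prod_diff {n : ℕ} {ι : Type*} (Q : Finset ι) (M : ι → (Fin n → ℝ) →ₗ[ℝ] ℝ) (Λ r : ℝ)
    (hΛ : 0 ≤ Λ) (hr : 0 ≤ r) (hM : ∀ i s, |M i s| ≤ Λ * ‖s‖) (s t : Fin n → ℝ) (hs : ‖s‖ ≤ r)
    (ht : ‖t‖ ≤ r) :
    |∏ i ∈ Q, M i s| ≤ (Λ * r) ^ Q.card ∧
    |∏ i ∈ Q, M i s - ∏ i ∈ Q, M i t| * r ≤ Q.card * (Λ * r) ^ Q.card * ‖s - t‖ := by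
  classical
  induction Q using Finset.induction_on with
  | empty => simp
  | insert a Q ha ih =>
    obtain ⟨ih1, ih2⟩ := ih
    have hs' : |M a s| ≤ Λ * r := (hM a s).trans (by gcongr)
    have ht' : |M a t| ≤ Λ * r := (hM a t).trans (by gcongr)
    have hst := hM a (s - t)
    have hp : 0 ≤ Λ * r := by positivity
    rw [Finset.prod_insert ha, Finset.prod_insert ha, Finset.card_insert_of_notMem ha]
    refine ⟨?_, ?_⟩
    · rw [abs_mul, pow_succ, mul_comm]
      exact mul_le_mul ih1 hs' (abs_nonneg _) (by positivity)
    · have e : M a s * ∏ i ∈ Q, M i s - M a t * ∏ i ∈ Q, M i t =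
          M a (s - t) * ∏ i ∈ Q, M i s + M a t * (∏ i ∈ Q, M i s - ∏ i ∈ Q, M i t) := by
        rw [map_sub]; ring
      rw [e]
      calc _ ≤ (|M a (s - t)| * |∏ i ∈ Q, M i s| +
            |M a t| * |∏ i ∈ Q, M i s - ∏ i ∈ Q, M i t|) * r := by
            gcongr
            refine (abs_add_le _ _).trans ?_
            rw [abs_mul, abs_mul]
        _ = |M a (s - t)| * |∏ i ∈ Q, M i s| * r +
            |M a t| * (|∏ i ∈ Q, M i s - ∏ i ∈ Q, M i t| * r) := by ring
        _ ≤ (Λ * ‖s - t‖) * (Λ * r) ^ Q.card * r +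
            (Λ * r) * (Q.card * (Λ * r) ^ Q.card * ‖s - t‖) := by gcongr
        _ = _ := by push_cast; ring

lemma aux_approx_term {n k : ℕ} (D : Fin (k + 2) → ℝ) (M : Fin (k + 2) → (Fin n → ℝ) →ₗ[ℝ] ℝ)
    (Λ R P : ℝ) (hΛ : 0 ≤ Λ) (hR : 0 < R) (hP : 0 ≤ P) (hM : ∀ i s, |M i s| ≤ Λ * ‖s‖)
    (S : Finset (Fin (k + 2)))
    (hS : S.card ≤ k → |∏ i ∈ S, D i| * R ^ (k - S.card) ≤ P) :
    Approx R ((k + 2) * (Λ + 1) ^ (k + 2) * P)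
      (fun s => (∏ i ∈ S, D i) * ∏ i ∈ Sᶜ, M i s) := by
  have hK : 0 ≤ (k + 2) * (Λ + 1) ^ (k + 2) * P := by positivity
  have hcard : S.card + Sᶜ.card = k + 2 := by
    rw [Finset.card_add_card_compl, Fintype.card_fin]
  by_cases h2 : S.card ≤ k
  · refine ⟨0, fun r s t h0 hr hs ht => ?_⟩
    have hd := (aux_prod_diff Sᶜ M Λ r hΛ h0.le hM s t hs ht).2
    obtain ⟨q, hq⟩ := Nat.exists_eq_add_of_le h2
    have hq' : Sᶜ.card = q + 2 := by omega
    have hS' := hS h2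
    rw [hq'] at hd
    have hkq : k - S.card = q := by omega
    rw [hkq] at hS'
    rw [LinearMap.zero_apply, sub_zero, ← mul_sub, abs_mul]
    have hd' : |∏ i ∈ Sᶜ, M i s - ∏ i ∈ Sᶜ, M i t| ≤
        (k + 2) * (Λ + 1) ^ (k + 2) * R ^ q * r * ‖s - t‖ := by
      refine le_of_mul_le_mul_right (hd.trans ?_) h0
      have h3 : (((q + 2 : ℕ)) : ℝ) ≤ k + 2 := by
        have : q + 2 ≤ k + 2 := by omega
        exact_mod_cast this
      have h4 : Λ ^ (q + 2) ≤ (Λ + 1) ^ (k + 2) := by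
        calc Λ ^ (q + 2) ≤ (Λ + 1) ^ (q + 2) := by gcongr; linarith
          _ ≤ _ := by
            apply pow_le_pow_right₀ (by linarith); omega
      calc ((q + 2 : ℕ) : ℝ) * (Λ * r) ^ (q + 2) * ‖s - t‖
          = ((q + 2 : ℕ) : ℝ) * Λ ^ (q + 2) * r ^ q * r * ‖s - t‖ * r := by ring
        _ ≤ _ := by gcongr
    calc _ ≤ |∏ i ∈ S, D i| * ((k + 2) * (Λ + 1) ^ (k + 2) * R ^ q * r * ‖s - t‖) := by gcongr
      _ = (k + 2) * (Λ + 1) ^ (k + 2) * (|∏ i ∈ S, D i| * R ^ q) * r * ‖s - t‖ := by ring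
      _ ≤ _ := by gcongr
  · have h3 : Sᶜ.card ≤ 1 := by omega
    rcases Nat.le_one_iff_eq_zero_or_eq_one.1 h3 with h | h
    · rw [Finset.card_eq_zero] at h
      refine ⟨0, fun r s t h0 hr hs ht => ?_⟩
      rw [h]
      simp only [Finset.prod_empty, sub_self, LinearMap.zero_apply, abs_zero]
      positivity
    · obtain ⟨a, ha⟩ := Finset.card_eq_one.1 h
      refine ⟨(∏ i ∈ S, D i) • M a, fun r s t h0 hr hs ht => ?_⟩
      rw [ha]
      simp only [Finset.prod_singleton, LinearMap.smul_apply, smul_eq_mul]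
      rw [map_sub]
      have : (∏ i ∈ S, D i) * M a s - (∏ i ∈ S, D i) * M a t - (∏ i ∈ S, D i) * (M a s - M a t)
        = 0 := by ring
      rw [this, abs_zero]
      positivity

lemma Approx.mono {n : ℕ} {R K K' : ℝ} {f : (Fin n → ℝ) → ℝ} (h : Approx R K f) (hK : K ≤ K') :
    Approx R K' f := by
  obtain ⟨L, hL⟩ := h
  refine ⟨L, fun r s t h0 hr hs ht => (hL r s t h0 hr hs ht).trans ?_⟩
  gcongr

lemma aux_approx_det {n k : ℕ} (l : Fin n → ℝ) (N : Fin n → Fin n → (Fin n → ℝ) →ₗ[ℝ] ℝ)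
    (a : ℕ → ℝ) (ha0 : ∀ i, 0 ≤ a i) (ha : Antitone a) (hl : ∀ i, |l i| ≤ a i)
    (Λ R P : ℝ) (hΛ : 0 ≤ Λ) (hR : 0 < R) (hP : 0 ≤ P) (hN : ∀ i j s, |N i j s| ≤ Λ * ‖s‖)
    (haP : ∀ q ≤ k, (∏ j ∈ Finset.range q, a j) * R ^ (k - q) ≤ P) (f g : Fin (k + 2) → Fin n) :
    Approx R (((k + 2).factorial * 2 ^ (k + 2) : ℕ) * ((k + 2) * (Λ + 1) ^ (k + 2) * P))
      (fun s => ((diagonal l + Matrix.of fun i j => N i j s).submatrix f g).det) := by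
  by_cases hf : Function.Injective f
  swap
  · obtain ⟨i, j, hij, hne⟩ : ∃ i j, f i = f j ∧ i ≠ j := by
      simpa [Function.Injective] using hf
    refine ⟨0, fun r s t h0 hr hs ht => ?_⟩
    have hz : ∀ s, ((diagonal l + Matrix.of fun i j => N i j s).submatrix f g).det = 0 :=
      fun s => Matrix.det_zero_of_row_eq hne (by funext k; simp [hij])
    simp only [hz, sub_self, LinearMap.zero_apply, abs_zero]
    positivity
  have hfun : (fun s => ((diagonal l + Matrix.of fun i j => N i j s).submatrix f g).det) =
      fun s => ∑ e : Equiv.Perm (Fin (k + 2)), ((Equiv.Perm.sign e : ℤ) : ℝ) *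
        ∑ S : Finset (Fin (k + 2)), ((∏ i ∈ S, diagonal l (f i) (g (e i))) *
          ∏ i ∈ Sᶜ, N (f i) (g (e i)) s) := by
    funext s
    rw [← Matrix.det_transpose, Matrix.det_apply']
    refine Finset.sum_congr rfl fun e _ => ?_
    congr 1
    simp only [Matrix.transpose_apply, Matrix.submatrix_apply, Matrix.add_apply, Matrix.of_apply]
    rw [Finset.prod_add, Finset.powerset_univ]
    rfl
  rw [hfun]
  refine (Approx.sum Finset.univ R (fun _ => ∑ S : Finset (Fin (k + 2)),
    ((k + 2) * (Λ + 1) ^ (k + 2) * P)) _ fun e _ => ?_).mono (le_of_eq ?_)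
  · refine Approx.const_mul (Approx.sum Finset.univ R _ _ fun S _ => ?_) _ ?_
    · refine aux_approx_term (fun i => diagonal l (f i) (g (e i)))
        (fun i => N (f i) (g (e i))) Λ R P hΛ hR hP (fun i s => hN _ _ s) S ?_
      intro hS
      refine le_trans ?_ (haP _ hS)
      gcongr
      rw [Finset.abs_prod]
      refine (Finset.prod_le_prod (g := fun i => a (f i)) (fun i _ => abs_nonneg _) ?_).trans
        (aux_prod_inj a ha0 ha f hf S)
      intro i _
      rw [Matrix.diagonal_apply]
      split_ifs
      · exact hl _
      · simpa using ha0 _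
    · rcases Int.units_eq_one_or (Equiv.Perm.sign e) with h | h <;> simp [h]
  · simp [Fintype.card_perm]
    ring

/-- The constant of the Taylor estimate. -/
noncomputable def taylorConst (n k : ℕ) : ℝ :=
  ((n ^ (k + 2) * n ^ (k + 2) : ℕ) : ℝ) * ((((k + 2).factorial * 2 ^ (k + 2) : ℕ) : ℝ) *
    ((k + 2) * ((n * (n * (6 * n)) : ℝ) + 1) ^ (k + 2)))

lemma aux_taylorConst_nonneg (n k : ℕ) : 0 ≤ taylorConst n k := by
  unfold taylorConst; positivity

lemma aux_minor_approx {n k : ℕ} (c : MvPolynomial (Fin n) ℝ) (hc : c.IsHomogeneous 3)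
    (x0 : Fin n → ℝ) (U : Matrix (Fin n) (Fin n) ℝ) (hU : U * Uᵀ = 1) (hU' : Uᵀ * U = 1)
    (l : Fin n → ℝ) (hx0 : hessMat c x0 = U * diagonal l * Uᵀ)
    (a : ℕ → ℝ) (ha0 : ∀ i, 0 ≤ a i) (ha : Antitone a) (hl : ∀ i, |l i| ≤ a i)
    (R P : ℝ) (hR : 0 < R) (hP : 0 ≤ P)
    (haP : ∀ q ≤ k, (∏ j ∈ Finset.range q, a j) * R ^ (k - q) ≤ P) (r c' : Fin (k + 2) → Fin n) :
    Approx R (taylorConst n k * P) (fun s => ((hessMat c (x0 + s)).submatrix r c').det) := by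
  let N : Fin n → Fin n → (Fin n → ℝ) →ₗ[ℝ] ℝ := fun i j =>
    { toFun := fun s => (Uᵀ * hessMat c s * U) i j
      map_add' := fun s t => by
        rw [aux_hess_add c hc, Matrix.mul_add, Matrix.add_mul, Matrix.add_apply]
      map_smul' := fun b s => by
        rw [aux_hess_smul c hc, Matrix.mul_smul, Matrix.smul_mul, Matrix.smul_apply]; rfl }
  have hU2 : Uᵀ * Uᵀᵀ = 1 := by simpa using hU'
  have hN : ∀ i j s, |N i j s| ≤ (n * (n * (6 * n)) : ℝ) * ‖s‖ := by
    intro i j s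
    change |(Uᵀ * hessMat c s * U) i j| ≤ _
    rw [Matrix.mul_apply]
    have h1 : ∀ k, |(Uᵀ * hessMat c s) i k| ≤ n * (6 * n * ‖s‖) := by
      intro k
      rw [Matrix.mul_apply]
      calc _ ≤ ∑ j : Fin n, 6 * n * ‖s‖ := by
            refine (Finset.abs_sum_le_sum_abs _ _).trans (Finset.sum_le_sum fun j _ => ?_)
            rw [abs_mul]
            calc _ ≤ 1 * (6 * n * ‖s‖) := mul_le_mul (aux_orth_entry _ hU2 _ _)
                  (aux_hess_bound c hc s _ _) (abs_nonneg _) zero_le_one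
              _ = _ := one_mul _
        _ = _ := by simp
    calc _ ≤ ∑ j : Fin n, n * (6 * n * ‖s‖) := by
          refine (Finset.abs_sum_le_sum_abs _ _).trans (Finset.sum_le_sum fun k _ => ?_)
          rw [abs_mul]
          calc _ ≤ (n * (6 * n * ‖s‖)) * 1 := mul_le_mul (h1 k) (aux_orth_entry _ hU _ _)
                (abs_nonneg _) (by positivity)
            _ = _ := mul_one _
      _ = _ := by simp; ring
  have hfun : (fun s => ((hessMat c (x0 + s)).submatrix r c').det) = fun s =>
      ∑ f : Fin (k + 2) → Fin n, ∑ g : Fin (k + 2) → Fin n,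
      ((∏ i, U (r i) (f i)) * (∏ i, U (c' i) (g i))) *
        ((diagonal l + Matrix.of fun i j => N i j s).submatrix f g).det := by
    funext s
    rw [← aux_det_expand]
    congr 2
    have : (Matrix.of fun i j => N i j s) = Uᵀ * hessMat c s * U := rfl
    rw [this, Matrix.mul_add, Matrix.add_mul, ← hx0, aux_hess_add c hc]
    congr 1
    calc hessMat c s = (U * Uᵀ) * hessMat c s * (U * Uᵀ) := by rw [hU]; simp
      _ = _ := by simp only [Matrix.mul_assoc]
  have hprod : ∀ (r f : Fin (k + 2) → Fin n), |∏ i, U (r i) (f i)| ≤ 1 := by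
    intro r f
    rw [Finset.abs_prod]
    exact Finset.prod_le_one (fun i _ => abs_nonneg _) (fun i _ => aux_orth_entry U hU _ _)
  rw [hfun]
  refine (Approx.sum Finset.univ R _ _ fun f _ => Approx.sum Finset.univ R _ _ fun g _ =>
    Approx.const_mul (aux_approx_det l N a ha0 ha hl (n * (n * (6 * n))) R P (by positivity) hR hP
      hN haP f g) _ ?_).mono (le_of_eq ?_)
  · rw [abs_mul]
    exact mul_le_one₀ (hprod _ _) (abs_nonneg _) (hprod _ _)
  · unfold taylorConst
    simp
    ring

lemma aux_taylor {n m : ℕ} (c : MvPolynomial (Fin n) ℝ) (x0 : Fin n → ℝ) (p : MIdx n m) (R K : ℝ)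
    (hR : 0 < R)
    (h : Approx R K (fun s => ((hessMat c (x0 + s)).submatrix p.1.1 p.1.2).det))
    (r : ℝ) (s t : Fin n → ℝ) (h0 : 0 < r) (hr : r ≤ R) (hs : ‖s‖ ≤ r) (ht : ‖t‖ ≤ r) :
    |minorsVec c m (x0 + s) p - minorsVec c m (x0 + t) p - jacMulVec c m x0 (s - t) p|
      ≤ K * r * ‖s - t‖ := by
  obtain ⟨L, hL⟩ := h
  simp only [← aux_minors_eq] at hL
  have hLj : ∀ v, jacMulVec c m x0 v p = L v := by
    intro v
    have h1 := aux_hasDerivAt (minorPoly c m p) x0 v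
    refine h1.unique ?_
    rw [hasDerivAt_iff_isLittleO_nhds_zero]
    have hO : (fun τ : ℝ => MvPolynomial.eval (x0 + (0 + τ) • v) (minorPoly c m p) -
        MvPolynomial.eval (x0 + (0 : ℝ) • v) (minorPoly c m p) - τ • L v) =O[nhds 0]
        fun τ : ℝ => τ ^ 2 := by
      refine Asymptotics.IsBigO.of_bound (|K| * (‖v‖ + 1) * ‖v‖) ?_
      have hv1 : 0 < ‖v‖ + 1 := by positivity
      have hev : ∀ᶠ τ : ℝ in nhds 0, |τ| < R / (‖v‖ + 1) := by
        have hc : Continuous fun τ : ℝ => |τ| := continuous_abs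
        exact hc.continuousAt.eventually_lt continuousAt_const (by simp; positivity)
      filter_upwards [hev] with τ hτ
      rcases eq_or_ne τ 0 with rfl | hne
      · simp
      · have hτ0 : 0 < |τ| := abs_pos.2 hne
        rw [lt_div_iff₀ hv1] at hτ
        have h2 := hL (|τ| * (‖v‖ + 1)) (τ • v) 0 (by positivity) hτ.le (by
          rw [norm_smul, Real.norm_eq_abs]; gcongr; linarith) (by simp; positivity)
        rw [sub_zero, add_zero, map_smul, norm_smul] at h2
        rw [zero_add, zero_smul, add_zero, Real.norm_eq_abs, Real.norm_eq_abs]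
        refine (h2 : |minorsVec c m (x0 + τ • v) p - minorsVec c m x0 p - τ • L v| ≤ _).trans ?_
        rw [abs_pow, Real.norm_eq_abs]
        calc K * (|τ| * (‖v‖ + 1)) * (|τ| * ‖v‖) ≤ |K| * (|τ| * (‖v‖ + 1)) * (|τ| * ‖v‖) := by
              gcongr; exact le_abs_self K
          _ = _ := by ring
    refine hO.trans_isLittleO ?_
    exact Asymptotics.isLittleO_pow_id (by norm_num)
  rw [hLj]
  exact hL r s t h0 hr hs ht

/-! ### The main argument -/

lemma aux_antitone {E : ℕ → ℝ} {k : ℕ} (hE : ∀ i, i < k → E (i + 1) ≤ E i) :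
    Antitone (fun i => E (min i k)) := by
  refine antitone_nat_of_succ_le fun i => ?_
  rcases lt_or_ge i k with h | h
  · rw [min_eq_left h.le, min_eq_left (Nat.succ_le_of_lt h)]
    exact hE i h
  · rw [min_eq_right h, min_eq_right (by omega)]

lemma aux_E_ge {E : ℕ → ℝ} {k : ℕ} (hE : ∀ i, i < k → E (i + 1) ≤ E i) {i : ℕ} (hi : i ≤ k) :
    E k ≤ E i := by
  have := aux_antitone hE hi
  simpa [hi] using this

lemma aux_K_le {n : ℕ} {B : ℝ} {lam : (Fin n → ℝ) → Fin n → ℝ} {E : ℕ → ℝ} {k : ℕ}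
    {x : Fin n → ℝ} (hx : x ∈ Kset B lam E k) (i : Fin n) : |lam x i| ≤ E (min (i : ℕ) k) := by
  rcases lt_or_ge (i : ℕ) k with h | h
  · rw [min_eq_left h.le]; exact (hx.2.1 i h).2
  · rw [min_eq_right h]; exact hx.2.2 i h

lemma aux_K_subset {n : ℕ} {B : ℝ} {lam : (Fin n → ℝ) → Fin n → ℝ} {E : ℕ → ℝ} {k : ℕ}
    (hE : E (k + 1) ≤ E k) : Kset B lam E (k + 1) ⊆ Kset B lam E k := by
  intro x hx
  refine ⟨hx.1, fun i hi => hx.2.1 i (by omega), fun i hi => ?_⟩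
  rcases hi.eq_or_lt with h | h
  · have := (hx.2.1 i (by omega)).2
    rwa [← h] at this
  · exact (hx.2.2 i h).trans hE

lemma aux_supM_le {n k : ℕ} (w : MIdx n k → ℝ) [Fintype (MIdx n k)] : supMIdx w ≤ ‖w‖ :=
  Real.iSup_le (fun p => norm_le_pi_norm w p) (norm_nonneg _)

lemma aux_base (n : ℕ) (C : ℝ) (hC : 1 ≤ C) : ∃ A : ℝ, 0 < A ∧
    ∀ (c : MvPolynomial (Fin n) ℝ), c.IsHomogeneous 3 →
      ∀ lam : (Fin n → ℝ) → Fin n → ℝ,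
        (∀ x, (hessMat c x).charpoly = ∏ i, (Polynomial.X - Polynomial.C (lam x i))) →
      ∀ B : ℝ, 1 ≤ B → ∀ σ : ℕ, σ ≤ n → ∀ E : ℕ → ℝ, E 0 ≤ C * B → 1 ≤ E 0 →
      (¬ ∃ X : Submodule ℝ (Fin n → ℝ), Module.finrank ℝ X = σ + 1 ∧
            ∀ v ∈ X, ∀ i j, |hessMat c v i j| ≤ C⁻¹ * ‖v‖) →
      Cov (Kset B lam E 0) (E 0) (A * (B / E 0) ^ σ) := by
  have hC0 : 0 < C := by linarith
  set Nι : ℝ := ((Fintype.card (Fin n × Fin n) : ℕ) : ℝ) with hNι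
  set K1 : ℝ := ((n ^ 1 * n ^ 1 * (1).factorial : ℕ) : ℝ) with hK1
  set M : ℝ := n * (1 + (n + 1) * (Nι + 1) * (C * (2 * K1))) with hM
  have hM0 : 0 ≤ M := by positivity
  refine ⟨(2 * n + C) ^ n * (2 * M + 1) ^ n, by positivity, ?_⟩
  intro c hc lam hlam B hB σ hσ E hEB hE1 hIII
  have hE0 : 0 < E 0 := by linarith
  push Not at hIII
  let L : (Fin n → ℝ) →ₗ[ℝ] (Fin n × Fin n → ℝ) :=
    { toFun := fun v p => hessMat c v p.1 p.2
      map_add' := fun s t => by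
        funext p
        rw [aux_hess_add c hc]; rfl
      map_smul' := fun b s => by
        funext p
        rw [aux_hess_smul c hc]; rfl }
  obtain ⟨S, hS, W, hW1, hW2⟩ := aux_sv L C⁻¹ (by positivity) σ (by
    intro X hX
    obtain ⟨v, hv, i, j, hij⟩ := hIII X hX
    exact ⟨v, hv, hij.trans_le (norm_le_pi_norm (L v) (i, j))⟩)
  rw [← hNι, inv_inv] at hW2
  have hent : ∀ x ∈ Kset B lam E 0, ∀ i j, |hessMat c x i j| ≤ K1 * E 0 := by
    intro x hx i j
    obtain ⟨U, hU, hU', hd⟩ := aux_diag_lam _ (aux_hess_symm c x) (lam x) (hlam x)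
    have h := aux_minor_upper (m := 1) U hU (lam x) (fun _ => E 0) (fun _ => hE0.le)
      antitone_const (fun i => by simpa using aux_K_le hx i) (fun _ => i) (fun _ => j)
    rw [← hd] at h
    simpa [Matrix.det_fin_one, hK1] using h
  have hcov := aux_cov_proj (Kset B lam E 0) 0 B M (E 0) hM0 (by linarith) hE0 (by
    intro x hx
    rw [sub_zero, pi_norm_le_iff_of_nonneg (by linarith)]
    exact hx.1) S W hW1 (by
    intro x hx y hy hxy
    have h1 := hW2 (x - y) (E 0) hE0.le hxy
    have h2 : ‖L (x - y)‖ ≤ 2 * K1 * E 0 := by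
      rw [map_sub, pi_norm_le_iff_of_nonneg (by positivity)]
      intro p
      rw [Pi.sub_apply, Real.norm_eq_abs]
      refine (abs_sub _ _).trans ?_
      have a1 : |L x p| ≤ K1 * E 0 := hent x hx p.1 p.2
      have a2 : |L y p| ≤ K1 * E 0 := hent y hy p.1 p.2
      linarith
    calc ‖x - y‖ ≤ _ := h1
      _ ≤ n * (E 0 + (n + 1) * (Nι + 1) * (C * (2 * K1 * E 0))) := by gcongr
      _ = M * E 0 := by rw [hM]; ring)
  refine hcov.mono subset_rfl ?_
  have hBE : 0 < B / E 0 := by positivity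
  have h1 : 1 ≤ C * (B / E 0) := by
    rw [← mul_div_assoc, le_div_iff₀ hE0]; linarith
  calc (2 * n * B / E 0 + 1) ^ S.card * (2 * M + 1) ^ n
      ≤ (2 * n * B / E 0 + 1) ^ σ * (2 * M + 1) ^ n := by
        gcongr
        have : 0 ≤ 2 * n * B / E 0 := by positivity
        linarith
    _ ≤ ((2 * n + C) * (B / E 0)) ^ σ * (2 * M + 1) ^ n := by
        gcongr
        have : 2 * n * B / E 0 = 2 * n * (B / E 0) := by ring
        rw [this]; linarith
    _ = (2 * n + C) ^ σ * (B / E 0) ^ σ * (2 * M + 1) ^ n := by rw [mul_pow]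
    _ ≤ (2 * n + C) ^ n * (B / E 0) ^ σ * (2 * M + 1) ^ n := by
        gcongr
        have : (0 : ℝ) ≤ n := by positivity
        linarith
    _ = _ := by ring

lemma aux_haP {E : ℕ → ℝ} {k : ℕ} (hE : ∀ i, i < k + 1 → E (i + 1) ≤ E i) (hE1 : 1 ≤ E (k + 1))
    (q : ℕ) (hq : q ≤ k) :
    (∏ j ∈ Finset.range q, E (min j (k + 1))) * (E k) ^ (k - q) ≤ ∏ j ∈ Finset.range k, E j := by
  have hge : ∀ i ≤ k, E k ≤ E i := fun i hi => aux_E_ge (fun j hj => hE j (by omega)) hi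
  have hEk : 1 ≤ E k := hE1.trans (hE k (by omega))
  obtain ⟨d, rfl⟩ := Nat.exists_eq_add_of_le hq
  rw [Finset.prod_range_add, Nat.add_sub_cancel_left]
  have e : ∏ j ∈ Finset.range q, E (min j (q + d + 1)) = ∏ j ∈ Finset.range q, E j := by
    refine Finset.prod_congr rfl fun j hj => ?_
    rw [Finset.mem_range] at hj
    rw [min_eq_left (by omega)]
  rw [e]
  refine mul_le_mul_of_nonneg_left ?_ (Finset.prod_nonneg fun j hj => ?_)
  · calc E (q + d) ^ d = ∏ j ∈ Finset.range d, E (q + d) := by simp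
      _ ≤ _ := by
        refine Finset.prod_le_prod (fun _ _ => by linarith) fun j hj => ?_
        rw [Finset.mem_range] at hj
        exact hge _ (by omega)
  · rw [Finset.mem_range] at hj
    linarith [hge j (by omega)]

set_option maxHeartbeats 2000000 in
lemma aux_local (n k : ℕ) (C : ℝ) (hC : 1 ≤ C) : ∃ A δ : ℝ, 0 < A ∧ 0 < δ ∧
    ∀ (c : MvPolynomial (Fin n) ℝ), c.IsHomogeneous 3 →
      ∀ lam : (Fin n → ℝ) → Fin n → ℝ,
        (∀ x, (hessMat c x).charpoly = ∏ i, (Polynomial.X - Polynomial.C (lam x i))) →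
      ∀ B : ℝ, ∀ σ : ℕ, σ + k + 2 ≤ n → ∀ E : ℕ → ℝ,
      (∀ i, i < k + 1 → E (i + 1) ≤ E i) → 1 ≤ E (k + 1) →
      (∀ x0 ∈ Kset B lam E (k + 1), ∀ X : Submodule ℝ (Fin n → ℝ),
          Module.finrank ℝ X = σ + (k + 1) + 1 →
          ∃ v ∈ X, C⁻¹ * supMIdx (minorsVec c (k + 1) x0) * ‖v‖ <
            supMIdx (jacMulVec c (k + 1 + 1) x0 v)) →
      ∀ z : Fin n → ℝ,
      Cov (Kset B lam E (k + 1) ∩ {x | ∀ i, z i ≤ x i ∧ x i ≤ z i + δ * E k}) (E (k + 1))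
        (A * (E k / E (k + 1)) ^ (σ + k + 1)) := by
  classical
  have hC0 : 0 < C := by linarith
  set K1 : ℝ := ((n ^ (k + 2) * n ^ (k + 2) * (k + 2).factorial : ℕ) : ℝ) with hK1
  set K2 : ℝ := ((n ^ (k + 1) * n ^ (k + 1) : ℕ) : ℝ) with hK2
  set κ : ℝ := (2 ^ (k + 1) * (K2 + 1))⁻¹ with hκ
  have hκ0 : 0 < κ := by positivity
  set Km : ℝ := n * ((n + 1) * (Fintype.card (MIdx n (k + 2)) + 1)) with hKm
  set T0 := taylorConst n k with hT0
  have hT00 : 0 ≤ T0 := aux_taylorConst_nonneg n k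
  set G : ℝ := C / κ with hG
  set δ : ℝ := (2 * (Km * G * T0) + 1)⁻¹ with hδ
  have hKGT : 0 ≤ Km * G * T0 := by positivity
  have hδ0 : 0 < δ := by positivity
  have hδ1 : δ ≤ 1 := inv_le_one_of_one_le₀ (by linarith)
  have hδ2 : Km * G * T0 * δ ≤ 1 / 2 := by
    rw [hδ, ← div_eq_mul_inv, div_le_iff₀ (by positivity)]; linarith
  set M : ℝ := 2 * (n + Km * G * (2 * K1)) with hM
  have hM0 : 0 ≤ M := by positivity
  refine ⟨(2 * n + 1) ^ n * (2 * M + 1) ^ n, δ, by positivity, hδ0, ?_⟩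
  intro c hc lam hlam B σ hσ E hE hE1 hII z
  set Kz := Kset B lam E (k + 1) ∩ {x | ∀ i, z i ≤ x i ∧ x i ≤ z i + δ * E k} with hKz
  have hge : ∀ i ≤ k + 1, 1 ≤ E i := fun i hi => hE1.trans (aux_E_ge hE hi)
  have hEk : 1 ≤ E k := hge k (by omega)
  have hE' : 0 < E (k + 1) := by linarith
  have hratio : 1 ≤ E k / E (k + 1) := by
    rw [one_le_div hE']; exact hE k (by omega)
  rcases Set.eq_empty_or_nonempty Kz with he | ⟨x0, hx0K, hx0z⟩
  · rw [he]
    exact ⟨∅, by simp; positivity, by simp⟩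
  set P' : ℝ := ∏ j ∈ Finset.range k, E j with hP'
  set P : ℝ := ∏ j ∈ Finset.range (k + 1), E j with hP
  have hP'0 : 0 < P' := Finset.prod_pos fun j hj => by
    rw [Finset.mem_range] at hj; linarith [hge j (by omega)]
  have hPP' : P = P' * E k := Finset.prod_range_succ _ _
  have hP0 : 0 < P := by rw [hPP']; positivity
  set a : ℕ → ℝ := fun i => E (min i (k + 1)) with ha
  have haanti : Antitone a := aux_antitone hE
  have ha0 : ∀ i, 0 ≤ a i := fun i => by linarith [hge (min i (k + 1)) (min_le_right _ _)]
  have haprod : ∏ j ∈ Finset.range (k + 2), a j = P * E (k + 1) := by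
    rw [Finset.prod_range_succ]
    congr 1
    · refine Finset.prod_congr rfl fun j hj => ?_
      rw [Finset.mem_range] at hj
      simp only [ha]
      rw [min_eq_left (by omega)]
    · simp [ha]
  -- upper bound for the minors
  have hup : ∀ x ∈ Kset B lam E (k + 1), ∀ p : MIdx n (k + 2),
      |minorsVec c (k + 2) x p| ≤ K1 * (P * E (k + 1)) := by
    intro x hx p
    obtain ⟨U, hU, hU', hd⟩ := aux_diag_lam _ (aux_hess_symm c x) (lam x) (hlam x)
    rw [aux_minors_eq, hd, ← haprod]
    exact aux_minor_upper U hU (lam x) a ha0 haanti (fun i => aux_K_le hx i) _ _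
  obtain ⟨U, hU, hU', hd⟩ := aux_diag_lam _ (aux_hess_symm c x0) (lam x0) (hlam x0)
  -- lower bound at x0
  have hlow : κ * P ≤ supMIdx (minorsVec c (k + 1) x0) := by
    have h1 := aux_minor_lower (m := k + 1) (by omega) (hessMat c x0) U hU' (lam x0) hd
    have h2 : (fun p : MIdx n (k + 1) => ((hessMat c x0).submatrix p.1.1 p.1.2).det) =
        minorsVec c (k + 1) x0 := by
      funext p; rw [aux_minors_eq]
    rw [h2, ← hK2] at h1
    have h3 : P / 2 ^ (k + 1) ≤ ∏ i : Fin (k + 1), |lam x0 (Fin.castLE (by omega) i)| := by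
      have : P / 2 ^ (k + 1) = ∏ i : Fin (k + 1), E i / 2 := by
        rw [Finset.prod_div_distrib, hP, Finset.prod_range]
        simp
      rw [this]
      refine Finset.prod_le_prod (fun i _ => ?_) fun i _ => ?_
      · have := hge (i : ℕ) (by have := i.2; omega)
        positivity
      · exact (hx0K.2.1 (Fin.castLE (by omega) i) (by have := i.2; simp; omega)).1.le
    have hs0 : 0 ≤ supMIdx (minorsVec c (k + 1) x0) := Real.iSup_nonneg fun p => abs_nonneg _
    have h4 : P / 2 ^ (k + 1) ≤ (K2 + 1) * supMIdx (minorsVec c (k + 1) x0) := by linarith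
    have h5 : κ * P = (P / 2 ^ (k + 1)) / (K2 + 1) := by rw [hκ]; field_simp
    rw [h5, div_le_iff₀ (by positivity)]
    linarith
  let L : (Fin n → ℝ) →ₗ[ℝ] (MIdx n (k + 2) → ℝ) :=
    { toFun := fun v => jacMulVec c (k + 2) x0 v
      map_add' := fun s t => by
        funext p
        simp [jacMulVec, mul_add, Finset.sum_add_distrib]
      map_smul' := fun b s => by
        funext p
        simp only [jacMulVec, Pi.smul_apply, smul_eq_mul, Finset.mul_sum, RingHom.id_apply]
        exact Finset.sum_congr rfl fun j _ => by ring }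
  have hε0 : 0 < C⁻¹ * (κ * P) := by positivity
  have hGe : (C⁻¹ * (κ * P))⁻¹ * P = G := by
    rw [hG]
    clear_value κ P
    field_simp
  obtain ⟨S, hS, W, hW1, hW2⟩ := aux_sv L (C⁻¹ * (κ * P)) hε0 (σ + (k + 1)) (by
    intro X hX
    obtain ⟨v, hv, hlt⟩ := hII x0 hx0K X hX
    refine ⟨v, hv, lt_of_le_of_lt ?_ (hlt.trans_le (aux_supM_le (L v)))⟩
    gcongr)
  have hx0d : ∀ x ∈ Kz, ‖x - x0‖ ≤ δ * E k := by
    intro x hx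
    rw [pi_norm_le_iff_of_nonneg (by positivity)]
    intro i
    have h1 := hx.2 i
    have h2 := hx0z i
    rw [Pi.sub_apply, Real.norm_eq_abs, abs_le]
    constructor <;> linarith
  have hcov := aux_cov_proj Kz x0 (δ * E k) M (E (k + 1)) hM0 (by positivity) hE' hx0d S W hW1 (by
    intro x hx y hy hxy
    have h1 := hW2 (x - y) (E (k + 1)) hE'.le hxy
    have h2 : ‖L (x - y)‖ ≤ P * (2 * K1 * E (k + 1) + T0 * δ * ‖x - y‖) := by
      rw [pi_norm_le_iff_of_nonneg (by positivity)]
      intro p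
      have happ := aux_minor_approx c hc x0 U hU hU' (lam x0) hd a ha0 haanti
        (fun i => aux_K_le hx0K i) (E k) P' (by linarith) hP'0.le (aux_haP hE hE1) p.1.1 p.1.2
      have ht := aux_taylor c x0 p (E k) _ (by linarith) happ (δ * E k) (x - x0) (y - x0)
        (by positivity) (by nlinarith) (hx0d x hx) (hx0d y hy)
      rw [add_sub_cancel, add_sub_cancel, sub_sub_sub_cancel_right] at ht
      have a1 := hup x hx.1 p
      have a2 := hup y hy.1 p
      change |jacMulVec c (k + 2) x0 (x - y) p| ≤ _
      have e1 : T0 * P' * (δ * E k) * ‖x - y‖ = P * (T0 * δ * ‖x - y‖) := by rw [hPP']; ring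
      rw [← hT0, e1] at ht
      rw [abs_le] at a1 a2 ht ⊢
      obtain ⟨b1, b2⟩ := a1
      obtain ⟨b3, b4⟩ := a2
      obtain ⟨b5, b6⟩ := ht
      have e4 : P * (2 * K1 * E (k + 1) + T0 * δ * ‖x - y‖) =
        2 * (K1 * (P * E (k + 1))) + P * (T0 * δ * ‖x - y‖) := by ring
      rw [e4]
      generalize K1 * (P * E (k + 1)) = u1 at *
      generalize P * (T0 * δ * ‖x - y‖) = u2 at *
      generalize jacMulVec c (k + 2) x0 (x - y) p = u3 at *
      constructor <;> linarith only [b1, b2, b3, b4, b5, b6]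
    have h3 : ‖x - y‖ ≤ n * E (k + 1) +
        Km * G * (2 * K1 * E (k + 1) + T0 * δ * ‖x - y‖) := by
      calc ‖x - y‖ ≤ _ := h1
        _ ≤ n * (E (k + 1) + (n + 1) * (Fintype.card (MIdx n (k + 2)) + 1) *
            ((C⁻¹ * (κ * P))⁻¹ * (P * (2 * K1 * E (k + 1) + T0 * δ * ‖x - y‖)))) := by gcongr
        _ = n * E (k + 1) + Km * ((C⁻¹ * (κ * P))⁻¹ * P) *
            (2 * K1 * E (k + 1) + T0 * δ * ‖x - y‖) := by rw [hKm]; ring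
        _ = _ := by rw [hGe]
    have h4 : Km * G * T0 * δ * ‖x - y‖ ≤ 1 / 2 * ‖x - y‖ :=
      mul_le_mul_of_nonneg_right hδ2 (norm_nonneg _)
    have e2 : Km * G * (2 * K1 * E (k + 1) + T0 * δ * ‖x - y‖) =
      Km * G * (2 * K1) * E (k + 1) + Km * G * T0 * δ * ‖x - y‖ := by ring
    rw [e2] at h3
    have e3 : M * E (k + 1) = 2 * (n * E (k + 1) + Km * G * (2 * K1) * E (k + 1)) := by
      rw [hM]; ring
    rw [e3]
    linarith)
  refine hcov.mono subset_rfl ?_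
  have hq0 : 0 ≤ 2 * n * (δ * E k) / E (k + 1) := by positivity
  calc (2 * n * (δ * E k) / E (k + 1) + 1) ^ S.card * (2 * M + 1) ^ n
      ≤ (2 * n * (δ * E k) / E (k + 1) + 1) ^ (σ + k + 1) * (2 * M + 1) ^ n := by
        gcongr
        · linarith
        · exact hS
    _ ≤ ((2 * n + 1) * (E k / E (k + 1))) ^ (σ + k + 1) * (2 * M + 1) ^ n := by
        gcongr
        have : 2 * n * (δ * E k) / E (k + 1) = 2 * n * (δ * (E k / E (k + 1))) := by ring
        rw [this]
        have : δ * (E k / E (k + 1)) ≤ E k / E (k + 1) := by nlinarith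
        have : 2 * (n : ℝ) * (δ * (E k / E (k + 1))) ≤ 2 * n * (E k / E (k + 1)) := by gcongr
        linarith
    _ = (2 * n + 1) ^ (σ + k + 1) * (E k / E (k + 1)) ^ (σ + k + 1) * (2 * M + 1) ^ n := by
        rw [mul_pow]
    _ ≤ (2 * n + 1) ^ n * (E k / E (k + 1)) ^ (σ + k + 1) * (2 * M + 1) ^ n := by
        gcongr
        · have : (0 : ℝ) ≤ n := by positivity
          linarith
        · omega
    _ = _ := by ring

lemma aux_step (n k : ℕ) (C : ℝ) (hC : 1 ≤ C) : ∃ A : ℝ, 0 < A ∧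
    ∀ (c : MvPolynomial (Fin n) ℝ), c.IsHomogeneous 3 →
      ∀ lam : (Fin n → ℝ) → Fin n → ℝ,
        (∀ x, (hessMat c x).charpoly = ∏ i, (Polynomial.X - Polynomial.C (lam x i))) →
      ∀ B : ℝ, ∀ σ : ℕ, σ + k + 2 ≤ n → ∀ E : ℕ → ℝ,
      (∀ i, i < k + 1 → E (i + 1) ≤ E i) → 1 ≤ E (k + 1) →
      (E (k + 1) < C⁻¹ * E k → ∀ x0 ∈ Kset B lam E (k + 1), ∀ X : Submodule ℝ (Fin n → ℝ),
          Module.finrank ℝ X = σ + (k + 1) + 1 →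
          ∃ v ∈ X, C⁻¹ * supMIdx (minorsVec c (k + 1) x0) * ‖v‖ <
            supMIdx (jacMulVec c (k + 1 + 1) x0 v)) →
      ∀ N, Cov (Kset B lam E k) (E k) N →
      Cov (Kset B lam E (k + 1)) (E (k + 1)) (N * (A * (E k / E (k + 1)) ^ (σ + k + 1))) := by
  have hC0 : 0 < C := by linarith
  obtain ⟨A, δ, hA, hδ, hloc⟩ := aux_local n k C hC
  refine ⟨(C + 1) ^ n + (1 / δ + 1) ^ n * A, by positivity, ?_⟩
  intro c hc lam hlam B σ hσ E hE hE1 hII N hN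
  have hE' : 0 < E (k + 1) := by linarith
  have hEk : 0 < E k := hE'.trans_le (hE k (by omega))
  have hratio : 1 ≤ E k / E (k + 1) := by
    rw [one_le_div hE']; exact hE k (by omega)
  have hpow : 1 ≤ (E k / E (k + 1)) ^ (σ + k + 1) := one_le_pow₀ hratio
  obtain ⟨T, hT1, hT2⟩ := hN
  set Q := ((C + 1) ^ n + (1 / δ + 1) ^ n * A) * (E k / E (k + 1)) ^ (σ + k + 1) with hQ
  have hQ0 : 0 ≤ Q := by positivity
  refine (aux_cov_union T (Kset B lam E (k + 1)) (fun z => Kset B lam E (k + 1) ∩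
    {x | ∀ i, z i ≤ x i ∧ x i ≤ z i + E k}) (E (k + 1)) Q ?_ ?_).mono subset_rfl (by gcongr)
  · intro x hx
    have := hT2 (aux_K_subset (hE k (by omega)) hx)
    simp only [Set.mem_iUnion] at this ⊢
    obtain ⟨z, hz, hxz⟩ := this
    exact ⟨z, hz, hx, hxz⟩
  · intro z _
    by_cases hlt : E (k + 1) < C⁻¹ * E k
    · obtain ⟨T', hT'1, hT'2⟩ := aux_cov_cube z (E k) (δ * E k) hEk.le (by positivity)
      refine (aux_cov_union T' _ (fun z' => Kset B lam E (k + 1) ∩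
        {x | ∀ i, z' i ≤ x i ∧ x i ≤ z' i + δ * E k}) (E (k + 1)) _ ?_
        (fun z' _ => hloc c hc lam hlam B σ hσ E hE hE1 (hII hlt) z')).mono subset_rfl ?_
      · rintro x ⟨hx, hxz⟩
        have := hT'2 hxz
        simp only [Set.mem_iUnion] at this ⊢
        obtain ⟨z, hz, hxz⟩ := this
        exact ⟨z, hz, hx, hxz⟩
      · have e : E k / (δ * E k) = 1 / δ := by field_simp
        rw [e] at hT'1
        calc (T'.card : ℝ) * (A * (E k / E (k + 1)) ^ (σ + k + 1))
            ≤ (1 / δ + 1) ^ n * (A * (E k / E (k + 1)) ^ (σ + k + 1)) := by gcongr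
          _ ≤ Q := by
            rw [hQ]
            have : 0 ≤ (C + 1) ^ n * (E k / E (k + 1)) ^ (σ + k + 1) := by positivity
            nlinarith
    · push Not at hlt
      refine (aux_cov_cube z (E k) (E (k + 1)) hEk.le hE').mono Set.inter_subset_right ?_
      have h1 : E k / E (k + 1) ≤ C := by
        rw [div_le_iff₀ hE']
        rwa [inv_mul_le_iff₀ hC0] at hlt
      calc (E k / E (k + 1) + 1) ^ n ≤ (C + 1) ^ n := by gcongr
        _ = (C + 1) ^ n * 1 := (mul_one _).symm
        _ ≤ ((C + 1) ^ n + (1 / δ + 1) ^ n * A) * (E k / E (k + 1)) ^ (σ + k + 1) := by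
          gcongr
          have : 0 ≤ (1 / δ + 1) ^ n * A := by positivity
          linarith
        _ = Q := rfl

lemma aux_main (n : ℕ) (C : ℝ) (hC : 1 ≤ C) (k : ℕ) : ∃ A : ℝ, 0 < A ∧
    ∀ (c : MvPolynomial (Fin n) ℝ), c.IsHomogeneous 3 →
      ∀ lam : (Fin n → ℝ) → Fin n → ℝ,
        (∀ x, (hessMat c x).charpoly = ∏ i, (Polynomial.X - Polynomial.C (lam x i))) →
      ∀ B : ℝ, 1 ≤ B → ∀ σ : ℕ, σ + k + 1 ≤ n →
      ∀ E : ℕ → ℝ, (∀ i, i < k → E (i + 1) ≤ E i) → E 0 ≤ C * B → 1 ≤ E k →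
        Cov (Kset B lam E k) (E k)
          (A * (B ^ σ * (∏ i ∈ Finset.range (k + 1), E i) / E k ^ (σ + k + 1))) ∨
        (∃ b : ℕ, 1 ≤ b ∧ b ≤ k ∧ ∃ x0 : Fin n → ℝ, x0 ∈ Kset B lam E b ∧
            E b < C⁻¹ * E (b - 1) ∧
            ∃ X : Submodule ℝ (Fin n → ℝ), Module.finrank ℝ X = σ + b + 1 ∧
              ∀ v ∈ X, supMIdx (jacMulVec c (b + 1) x0 v) ≤
                C⁻¹ * supMIdx (minorsVec c b x0) * ‖v‖) ∨
        (∃ X : Submodule ℝ (Fin n → ℝ), Module.finrank ℝ X = σ + 1 ∧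
            ∀ v ∈ X, ∀ i j, |hessMat c v i j| ≤ C⁻¹ * ‖v‖) := by
  induction k with
  | zero =>
    obtain ⟨A, hA, h⟩ := aux_base n C hC
    refine ⟨A, hA, ?_⟩
    intro c hc lam hlam B hB σ hσ E hE hEB hE1
    by_cases hIII : (∃ X : Submodule ℝ (Fin n → ℝ), Module.finrank ℝ X = σ + 1 ∧
            ∀ v ∈ X, ∀ i j, |hessMat c v i j| ≤ C⁻¹ * ‖v‖)
    · exact Or.inr (Or.inr hIII)
    · left
      refine (h c hc lam hlam B hB σ (by omega) E hEB hE1 hIII).mono subset_rfl (le_of_eq ?_)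
      have : E 0 ≠ 0 := by linarith
      simp only [zero_add, Finset.prod_range_one, add_zero, div_pow, pow_succ]
      field_simp
  | succ k ih =>
    obtain ⟨A, hA, hk⟩ := ih
    obtain ⟨A', hA', hstep⟩ := aux_step n k C hC
    refine ⟨A * A', by positivity, ?_⟩
    intro c hc lam hlam B hB σ hσ E hE hEB hE1
    have hkk := hE k (by omega)
    rcases hk c hc lam hlam B hB σ (by omega) E (fun i hi => hE i (by omega)) hEB
      (hE1.trans hkk) with h | ⟨b, hb1, hb2, hb3⟩ | h
    · by_cases hII : ∃ x0 : Fin n → ℝ, x0 ∈ Kset B lam E (k + 1) ∧ E (k + 1) < C⁻¹ * E k ∧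
            ∃ X : Submodule ℝ (Fin n → ℝ), Module.finrank ℝ X = σ + (k + 1) + 1 ∧
              ∀ v ∈ X, supMIdx (jacMulVec c (k + 1 + 1) x0 v) ≤
                C⁻¹ * supMIdx (minorsVec c (k + 1) x0) * ‖v‖
      · exact Or.inr (Or.inl ⟨k + 1, by omega, le_rfl, hII⟩)
      · left
        push Not at hII
        refine (hstep c hc lam hlam B σ (by omega) E hE hE1
          (fun hlt x0 hx0 X hX => hII x0 hx0 hlt X hX) _ h).mono subset_rfl (le_of_eq ?_)
        have h1 : E (k + 1) ≠ 0 := by linarith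
        have h2 : E k ≠ 0 := by linarith
        rw [Finset.prod_range_succ _ (k + 1), div_pow]
        rw [show σ + (k + 1) + 1 = (σ + k + 1) + 1 by ring, pow_succ (E (k + 1)) (σ + k + 1)]
        field_simp
    · exact Or.inr (Or.inl ⟨b, hb1, by omega, hb3⟩)
    · exact Or.inr (Or.inr h)

lemma aux_int_count {n : ℕ} (K : Set (Fin n → ℝ)) (T : Finset (Fin n → ℝ)) (ρ : ℝ) (hρ : 1 ≤ ρ)
    (hK : K ⊆ ⋃ z ∈ T, {x | ∀ i, z i ≤ x i ∧ x i ≤ z i + ρ}) :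
    (Set.ncard {x : Fin n → ℤ | (fun i => (x i : ℝ)) ∈ K} : ℝ) ≤ T.card * (2 * ρ) ^ n := by
  classical
  set F : Finset (Fin n → ℤ) := T.biUnion fun z =>
    Fintype.piFinset fun i => Finset.Icc ⌈z i⌉ ⌊z i + ρ⌋ with hF
  have hsub : {x : Fin n → ℤ | (fun i => (x i : ℝ)) ∈ K} ⊆ (F : Set (Fin n → ℤ)) := by
    intro x hx
    have := hK hx
    simp only [Set.mem_iUnion] at this
    obtain ⟨z, hz, hxz⟩ := this
    rw [Finset.mem_coe, hF, Finset.mem_biUnion]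
    refine ⟨z, hz, Fintype.mem_piFinset.2 fun i => ?_⟩
    rw [Finset.mem_Icc, Int.ceil_le, Int.le_floor]
    exact hxz i
  have h1 := Set.ncard_le_ncard hsub F.finite_toSet
  rw [Set.ncard_coe_finset] at h1
  calc _ ≤ (F.card : ℝ) := by exact_mod_cast h1
    _ ≤ ∑ z ∈ T, ((Fintype.piFinset fun i => Finset.Icc ⌈z i⌉ ⌊z i + ρ⌋).card : ℝ) := by
      exact_mod_cast Finset.card_biUnion_le
    _ ≤ ∑ z ∈ T, (2 * ρ) ^ n := by
      refine Finset.sum_le_sum fun z _ => ?_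
      rw [Fintype.card_piFinset]
      push_cast
      calc _ ≤ ∏ i : Fin n, (2 * ρ) := by
            refine Finset.prod_le_prod (fun i _ => by positivity) fun i _ => ?_
            rw [Int.card_Icc]
            have a1 := Int.floor_le (z i + ρ)
            have a2 := Int.le_ceil (z i)
            have a3 : (((⌊z i + ρ⌋ + 1 - ⌈z i⌉).toNat : ℤ) : ℝ) ≤ 2 * ρ := by
              rw [Int.toNat_eq_max]
              push_cast
              refine max_le (by linarith) (by linarith)
            exact_mod_cast a3
        _ = _ := by simp
    _ = _ := by simp

/-- Lemma 4.1 of the paper: one of the alternatives (I), (II),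
(III) holds.  Here `lam x` lists the eigenvalues of `H_c(x)` with multiplicity in
order of decreasing absolute value, and `E i` (for `0 ≤ i ≤ k`) is the paper's
`E_{i+1}`. -/
theorem statement7 (n : ℕ) (C : ℝ) (hC : 1 ≤ C) :
    ∃ A : ℝ, 0 < A ∧
      ∀ (c : MvPolynomial (Fin n) ℝ), c ≠ 0 → c.IsHomogeneous 3 →
      ∀ lam : (Fin n → ℝ) → Fin n → ℝ,
        (∀ x, (hessMat c x).charpoly =
          ∏ i, (Polynomial.X - Polynomial.C (lam x i))) →
        (∀ x, ∀ i j : Fin n, i ≤ j → |lam x j| ≤ |lam x i|) →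
      ∀ B : ℝ, 1 ≤ B → ∀ σ k : ℕ, σ ≤ n - 1 → k ≤ n - σ - 1 →
      ∀ E : ℕ → ℝ, (∀ i, i < k → E (i + 1) ≤ E i) → E 0 ≤ C * B → 1 ≤ E k →
        -- (I)ₖ : covering by boxes of side E_{k+1}
        (∃ T : Finset (Fin n → ℝ),
            (T.card : ℝ) ≤
              A * B ^ σ * (∏ i ∈ Finset.range (k + 1), E i) / E k ^ (σ + k + 1) ∧
            Kset B lam E k ⊆ ⋃ z ∈ T, {x | ∀ i, z i ≤ x i ∧ x i ≤ z i + E k} ∧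
            (Set.ncard {x : Fin n → ℤ | (fun i => (x i : ℝ)) ∈ Kset B lam E k} : ℝ) ≤
              A * B ^ σ * (∏ i ∈ Finset.range (k + 1), E i) * E k ^ (n - σ - k - 1)) ∨
        -- (II)ₖ : a point where the Jacobian of the (b+1) × (b+1) minors is close
        -- to having a kernel of dimension σ + b + 1
        (∃ b : ℕ, 1 ≤ b ∧ b ≤ k ∧ ∃ x0 : Fin n → ℝ, x0 ∈ Kset B lam E b ∧
            E b < C⁻¹ * E (b - 1) ∧
            ∃ X : Submodule ℝ (Fin n → ℝ), Module.finrank ℝ X = σ + b + 1 ∧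
              ∀ v ∈ X, supMIdx (jacMulVec c (b + 1) x0 v) ≤
                C⁻¹ * supMIdx (minorsVec c b x0) * ‖v‖) ∨
        -- (III) : a subspace of dimension σ + 1 where H_c is small
        (∃ X : Submodule ℝ (Fin n → ℝ), Module.finrank ℝ X = σ + 1 ∧
            ∀ v ∈ X, ∀ i j, |hessMat c v i j| ≤ C⁻¹ * ‖v‖) := by
  choose A hA hmain using aux_main n C hC
  set A0 : ℝ := ∑ k ∈ Finset.range (n + 1), A k with hA0
  have hle : ∀ k, k ≤ n → A k ≤ A0 := fun k hk =>
    Finset.single_le_sum (f := A) (fun i _ => (hA i).le) (Finset.mem_range.2 (by omega))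
  have hA0pos : 0 < A0 := (hA 0).trans_le (hle 0 (by omega))
  refine ⟨2 ^ n * A0, by positivity, ?_⟩
  intro c hc0 hc lam hlam _ B hB σ k hσ hk E hE hEB hE1
  have hn : 0 < n := by
    rcases Nat.eq_zero_or_pos n with h | h
    · subst h
      have h1 := hc.totalDegree hc0
      rw [eq_C_of_isEmpty c, totalDegree_C] at h1
      omega
    · exact h
  have hσk : σ + k + 1 ≤ n := by omega
  have hEk : 0 < E k := by linarith
  rcases hmain k c hc lam hlam B hB σ hσk E hE hEB hE1 with ⟨T, hT1, hT2⟩ | h | h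
  · left
    have hprod : 0 < ∏ i ∈ Finset.range (k + 1), E i := Finset.prod_pos fun i hi => by
      rw [Finset.mem_range] at hi
      linarith [aux_E_ge hE (show i ≤ k by omega)]
    set Y : ℝ := B ^ σ * (∏ i ∈ Finset.range (k + 1), E i) / E k ^ (σ + k + 1) with hY
    have hY0 : 0 ≤ Y := by positivity
    have hT3 : (T.card : ℝ) ≤ A0 * Y :=
      hT1.trans (mul_le_mul_of_nonneg_right (hle k (by omega)) hY0)
    refine ⟨T, ?_, hT2, ?_⟩
    · have e : 2 ^ n * A0 * B ^ σ * (∏ i ∈ Finset.range (k + 1), E i) / E k ^ (σ + k + 1)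
          = 2 ^ n * (A0 * Y) := by rw [hY]; ring
      rw [e]
      have h2 : (1 : ℝ) ≤ 2 ^ n := one_le_pow₀ (by norm_num)
      have : 0 ≤ A0 * Y := by positivity
      nlinarith
    · refine (aux_int_count _ T (E k) hE1 hT2).trans ?_
      calc (T.card : ℝ) * (2 * E k) ^ n ≤ (A0 * Y) * (2 * E k) ^ n := by gcongr
        _ = _ := by
          obtain ⟨m, hm⟩ := Nat.exists_eq_add_of_le hσk
          have e : n - σ - k - 1 = m := by omega
          rw [e, hY, mul_pow]
          have e2 : E k ^ n = E k ^ (σ + k + 1) * E k ^ m := by rw [← pow_add, ← hm]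
          rw [e2]
          field_simp
  · exact Or.inr (Or.inl h)
  · exact Or.inr (Or.inr h)
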